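/- arXiv:1511.06895 — 4 statements merged into one kernel-verified Lean document; each statement's English description precedes it below -/
import Mathlib

section
/- For every smooth bounded nonnegative function f : ℝⁿ → [0,∞) with bounded derivatives, ∫_{ℝⁿ} f^{3/2} dγ − (∫_{ℝⁿ} f dγ)^{3/2} ≤ ∫_{ℝⁿ} [ f^{3/2} − (1/√2)·(2f − √(f² + ‖∇f‖²))·√(f + √(f² + ‖∇f‖²)) ] dγ, where γ is the standard Gaussian measure on ℝⁿ. Equivalently, ∫_{ℝⁿ} (1/√2)·(2f − √(f² + ‖∇f‖²))·√(f + √(f² + ‖∇f‖²)) dγ ≤ (∫_{ℝⁿ} f dγ)^{3/2}. -/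
open MeasureTheory Real
open scoped BigOperators

/-- `becknerFun x q = Re (x + i√q)^{3/2}`. -/
noncomputable def becknerFun (x q : ℝ) : ℝ :=
  1 / √2 * (2 * x - √(x ^ 2 + q)) * √(x + √(x ^ 2 + q))

lemma exists_becknerFun_eq {x q : ℝ} (hx : 0 < x) (hq : 0 ≤ q) :
    ∃ a, 0 < a ∧ x ≤ a ^ 2 ∧ q = 4 * a ^ 2 * (a ^ 2 - x) ∧
      becknerFun x q = 3 * x * a - 2 * a ^ 3 := by
  have hr2 : √(x ^ 2 + q) ^ 2 = x ^ 2 + q := Real.sq_sqrt (by positivity)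
  have hxr : x ≤ √(x ^ 2 + q) := Real.le_sqrt_of_sq_le (by linarith)
  have hmul : √(x + √(x ^ 2 + q)) = √2 * √((x + √(x ^ 2 + q)) / 2) := by
    rw [← Real.sqrt_mul (by norm_num)]
    congr 1
    ring
  have ha2 : √((x + √(x ^ 2 + q)) / 2) ^ 2 = (x + √(x ^ 2 + q)) / 2 :=
    Real.sq_sqrt (by positivity)
  have h2 : √2 ≠ 0 := by positivity
  refine ⟨√((x + √(x ^ 2 + q)) / 2), by positivity, by rw [ha2]; linarith,
    by rw [ha2]; linarith, ?_⟩
  unfold becknerFun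
  rw [hmul, show ∀ u : ℝ, 2 * u ^ 3 = 2 * (u ^ 2 * u) by intro u; ring, ha2]
  field_simp
  ring

lemma becknerFun_zero_right {x : ℝ} (hx : 0 ≤ x) : becknerFun x 0 = x ^ (3 / 2 : ℝ) := by
  have h2 : √2 ≠ 0 := by positivity
  have h : √(x + x) = √2 * √x := by rw [← Real.sqrt_mul (by norm_num), two_mul]
  rw [show (3 / 2 : ℝ) = 1 + 1 / 2 by norm_num, Real.rpow_add_of_nonneg hx (by norm_num)
    (by norm_num), Real.rpow_one, ← Real.sqrt_eq_rpow, becknerFun, add_zero, Real.sqrt_sq hx, h]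
  field_simp
  ring

lemma continuous_becknerFun : Continuous fun p : ℝ × ℝ ↦ becknerFun p.1 p.2 := by
  unfold becknerFun
  fun_prop

/-- `becknerFun` dominates a family of functions that are affine in both variables. -/
lemma le_becknerFun {x q s : ℝ} (hx : 0 < x) (hq : 0 ≤ q) (hs : 0 < s) :
    3 / 2 * (s * x - s ^ 3 / 3 - q / (4 * s)) ≤ becknerFun x q := by
  obtain ⟨a, ha, hxa, rfl, h⟩ := exists_becknerFun_eq hx hq
  rw [h, ← sub_nonneg]
  have key : 3 * x * a - 2 * a ^ 3 -
      3 / 2 * (s * x - s ^ 3 / 3 - 4 * a ^ 2 * (a ^ 2 - x) / (4 * s)) =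
      (a - s) ^ 2 * (s ^ 2 + 2 * a * s + 3 * (a ^ 2 - x)) / (2 * s) := by
    field_simp
    ring
  rw [key]
  have : 0 ≤ a ^ 2 - x := by linarith
  positivity

lemma exists_becknerFun_eq_affine {x q : ℝ} (hx : 0 < x) (hq : 0 ≤ q) :
    ∃ s, 0 < s ∧ becknerFun x q = 3 / 2 * (s * x - s ^ 3 / 3 - q / (4 * s)) := by
  obtain ⟨a, ha, -, rfl, h⟩ := exists_becknerFun_eq hx hq
  refine ⟨a, ha, ?_⟩
  rw [h]
  field_simp
  ring

lemma sq_add_div_add_le {s t p m : ℝ} (hs : 0 < s) (ht : 0 < t) :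
    (p + m) ^ 2 / (s + t) ≤ p ^ 2 / s + m ^ 2 / t := by
  rw [div_add_div _ _ hs.ne' ht.ne', div_le_div_iff₀ (by positivity) (by positivity)]
  nlinarith [sq_nonneg (p * t - m * s)]

/-- The two-point inequality behind the `3/2`-Beckner inequality on the discrete cube. -/
lemma becknerFun_two_point {ι : Type*} [Fintype ι] {x₁ x₂ : ℝ} (h₁ : 0 < x₁) (h₂ : 0 < x₂)
    (p m : ι → ℝ) :
    (becknerFun x₁ (((x₁ - x₂) / 2) ^ 2 + ∑ k, p k ^ 2) +
      becknerFun x₂ (((x₁ - x₂) / 2) ^ 2 + ∑ k, m k ^ 2)) / 2 ≤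
      becknerFun ((x₁ + x₂) / 2) (∑ k, ((p k + m k) / 2) ^ 2) := by
  obtain ⟨s, hs, es⟩ := exists_becknerFun_eq_affine h₁
    (show 0 ≤ ((x₁ - x₂) / 2) ^ 2 + ∑ k, p k ^ 2 by positivity)
  obtain ⟨t, ht, et⟩ := exists_becknerFun_eq_affine h₂
    (show 0 ≤ ((x₁ - x₂) / 2) ^ 2 + ∑ k, m k ^ 2 by positivity)
  have hle := le_becknerFun (x := (x₁ + x₂) / 2) (q := ∑ k, ((p k + m k) / 2) ^ 2)
    (s := (s + t) / 2) (by positivity) (by positivity) (by positivity)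
  have hsum : (∑ k, (p k + m k) ^ 2) / (s + t) ≤ (∑ k, p k ^ 2) / s + (∑ k, m k ^ 2) / t := by
    rw [Finset.sum_div, Finset.sum_div, Finset.sum_div, ← Finset.sum_add_distrib]
    exact Finset.sum_le_sum fun k _ ↦ sq_add_div_add_le hs ht
  have hsq : ∑ k, ((p k + m k) / 2) ^ 2 = (∑ k, (p k + m k) ^ 2) / 4 := by
    rw [Finset.sum_div]
    exact Finset.sum_congr rfl fun k _ ↦ by ring
  rw [hsq] at hle ⊢
  set P := ∑ k, p k ^ 2
  set M := ∑ k, m k ^ 2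
  set S := ∑ k, (p k + m k) ^ 2
  obtain ⟨a, ha⟩ : ∃ a, a = (x₁ - x₂) / 2 := ⟨_, rfl⟩
  rw [← ha] at es et ⊢
  have hharm : 4 * a ^ 2 / (s + t) ≤ a ^ 2 / s + a ^ 2 / t := by
    refine le_trans (le_of_eq ?_) (sq_add_div_add_le hs ht (p := a) (m := a))
    ring
  have hquad : 0 ≤ (s + t) * ((s - t) / 2 - a / (s + t)) ^ 2 := by positivity
  have hquad' : (s + t) * ((s - t) / 2 - a / (s + t)) ^ 2 =
      (s + t) * (s - t) ^ 2 / 4 - (s - t) * a + a ^ 2 / (s + t) := by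
    field_simp
    ring
  have e1 : (a ^ 2 + P) / (4 * s) = (a ^ 2 / s + P / s) / 4 := by field_simp
  have e2 : (a ^ 2 + M) / (4 * t) = (a ^ 2 / t + M / t) / 4 := by field_simp
  have e3 : S / 4 / (4 * ((s + t) / 2)) = S / (s + t) / 8 := by field_simp; ring
  have e4 : 4 * a ^ 2 / (s + t) = 4 * (a ^ 2 / (s + t)) := by ring
  rw [e1] at es
  rw [e2] at et
  rw [e3] at hle
  rw [es, et]
  refine le_trans ?_ hle
  have hx₁ : x₁ = (x₁ + x₂) / 2 + a := by rw [ha]; ring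
  have hx₂ : x₂ = (x₁ + x₂) / 2 - a := by rw [ha]; ring
  generalize (x₁ + x₂) / 2 = x at *
  subst hx₁ hx₂
  nlinarith

lemma expect_option_cube {α : Type*} [Fintype α] [DecidableEq α] [DecidableEq (Option α)]
    (G : (Option α → Bool) → ℝ) :
    𝔼 ω, G ω = 𝔼 η : α → Bool,
      (G (fun o ↦ o.elim true η) + G (fun o ↦ o.elim false η)) / 2 := by
  have h : 𝔼 ω, G ω = 𝔼 p : Bool × (α → Bool), G (fun o ↦ o.elim p.1 p.2) := by
    refine Fintype.expect_equiv (Equiv.piOptionEquivProd (β := fun _ ↦ Bool)) _ _ fun ω ↦ ?_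
    congr 1
    funext o
    cases o <;> rfl
  rw [h, ← Finset.univ_product_univ, Finset.expect_product' _ _
    fun b η ↦ G (fun o ↦ o.elim b η)]
  simp only [Fintype.expect_eq_sum_div_card, Fintype.sum_bool, Fintype.card_bool,
    Finset.sum_add_distrib, ← Finset.sum_div]
  push_cast
  ring

/-- The `3/2`-Beckner inequality on the discrete cube. -/
theorem expect_becknerFun_cube_le (ι : Type) [Fintype ι] [DecidableEq ι] (F : (ι → Bool) → ℝ)
    (hF : ∀ ω, 0 < F ω) :
    (𝔼 ω, becknerFun (F ω) (∑ k, ((F ω - F (Function.update ω k (!ω k))) / 2) ^ 2)) ≤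
      (𝔼 ω, F ω) ^ (3 / 2 : ℝ) := by
  revert F
  refine Fintype.induction_empty_option (P := fun ι _ ↦ ∀ [DecidableEq ι] (F : (ι → Bool) → ℝ),
    (∀ ω, 0 < F ω) →
    (𝔼 ω, becknerFun (F ω) (∑ k, ((F ω - F (Function.update ω k (!ω k))) / 2) ^ 2)) ≤
      (𝔼 ω, F ω) ^ (3 / 2 : ℝ)) ?_ ?_ ?_ ι
  · intro α β _ e ih _ F hF
    let : Fintype α := Fintype.ofEquiv β e.symm
    let : DecidableEq α := e.decidableEq
    have h := ih (fun ω ↦ F (ω ∘ e.symm)) fun ω ↦ hF _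
    have e₁ : 𝔼 ω : α → Bool, F (ω ∘ e.symm) = 𝔼 ω, F ω :=
      Fintype.expect_equiv (e.arrowCongr (Equiv.refl Bool)) _ _ fun ω ↦ rfl
    rw [e₁] at h
    refine le_trans (le_of_eq ?_) h
    symm
    refine Fintype.expect_equiv (e.arrowCongr (Equiv.refl Bool)) _ _ fun ω ↦ ?_
    have e₂ : (e.arrowCongr (Equiv.refl Bool)) ω = ω ∘ e.symm := rfl
    rw [e₂]
    congr 1
    refine Fintype.sum_equiv e _ _ fun k ↦ ?_
    have e₃ : Function.update ω k (!ω k) ∘ e.symm =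
        Function.update (ω ∘ e.symm) (e k) (!(ω ∘ e.symm) (e k)) := by
      funext b
      by_cases hb : b = e k
      · subst hb; simp
      · have : e.symm b ≠ k := fun h ↦ hb (by rw [← h, e.apply_symm_apply])
        simp [Function.update_of_ne hb, Function.update_of_ne this]
    rw [e₃]
  · intro _ F hF
    simp [becknerFun_zero_right (hF _).le]
  · intro α _ ih _ F hF
    classical
    rw [expect_option_cube, expect_option_cube F]
    refine le_trans (Finset.expect_le_expect fun η _ ↦ ?_)
      (ih (fun η ↦ (F (fun o ↦ o.elim true η) + F (fun o ↦ o.elim false η)) / 2)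
        fun η ↦ by linarith [hF (fun o ↦ o.elim true η), hF (fun o ↦ o.elim false η)])
    have e₁ (b c : Bool) : Function.update (fun o : Option α ↦ o.elim b η) none c =
        fun o ↦ o.elim c η := by
      funext o
      cases o <;> simp
    have e₂ (b : Bool) (k : α) : Function.update (fun o : Option α ↦ o.elim b η) (some k) (!η k) =
        fun o ↦ o.elim b (Function.update η k (!η k)) := by
      funext o
      cases o <;> simp [Function.update_apply]
    have h := becknerFun_two_point (hF (fun o ↦ o.elim true η)) (hF (fun o ↦ o.elim false η))
      (fun k ↦ (F (fun o ↦ o.elim true η) -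
        F (fun o ↦ o.elim true (Function.update η k (!η k)))) / 2)
      (fun k ↦ (F (fun o ↦ o.elim false η) -
        F (fun o ↦ o.elim false (Function.update η k (!η k)))) / 2)
    rw [Fintype.sum_option, Fintype.sum_option]
    simp only [Option.elim_none, Option.elim_some, e₁, e₂, Bool.not_true, Bool.not_false]
    rw [← neg_sq ((F (fun o ↦ o.elim false η) - F (fun o ↦ o.elim true η)) / 2), ← neg_div, neg_sub]
    refine h.trans_eq ?_
    congr 1
    exact Finset.sum_congr rfl fun k _ ↦ by ring

lemma integral_uniformOfFintype {Ω E : Type*} [Fintype Ω] [Nonempty Ω] [MeasurableSpace Ω]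
    [MeasurableSingletonClass Ω] [NormedAddCommGroup E] [NormedSpace ℝ E] [CompleteSpace E]
    (g : Ω → E) :
    ∫ ω, g ω ∂(PMF.uniformOfFintype Ω).toMeasure = (Fintype.card Ω : ℝ)⁻¹ • ∑ ω, g ω := by
  rw [PMF.integral_eq_sum, Finset.smul_sum]
  simp

/-- The sign attached to a bit. -/
def bitSign (b : Bool) : ℝ := if b then 1 else -1

lemma bitSign_not (b : Bool) : bitSign (!b) = -bitSign b := by
  cases b <;> simp [bitSign]

lemma bitSign_sq (b : Bool) : bitSign b ^ 2 = 1 := by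
  cases b <;> simp [bitSign]

/-- The rescaled simple random walk in `ℝⁿ`, with `N` steps in each coordinate direction. -/
noncomputable def cubeWalk (n N : ℕ) (ω : Fin n × Fin N → Bool) : EuclideanSpace ℝ (Fin n) :=
  WithLp.toLp 2 fun i ↦ (√N)⁻¹ * ∑ j, bitSign (ω (i, j))

lemma cubeWalk_update (n N : ℕ) (ω : Fin n × Fin N → Bool) (k : Fin n × Fin N) :
    cubeWalk n N (Function.update ω k (!ω k)) =
      cubeWalk n N ω - (2 * (√N)⁻¹ * bitSign (ω k)) • EuclideanSpace.single k.1 (1 : ℝ) := by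
  obtain ⟨i, j⟩ := k
  ext l
  simp only [cubeWalk, PiLp.sub_apply, PiLp.smul_apply, PiLp.single_apply, smul_eq_mul]
  by_cases hl : l = i
  · subst hl
    have h : ∑ m, bitSign (Function.update ω (l, j) (!ω (l, j)) (l, m)) =
        ∑ m, (bitSign (ω (l, m)) - if m = j then 2 * bitSign (ω (l, j)) else 0) := by
      refine Finset.sum_congr rfl fun m _ ↦ ?_
      by_cases hm : m = j
      · subst hm
        simp only [Function.update_self, bitSign_not, if_true]
        ring
      · simp [hm]
    rw [h, Finset.sum_sub_distrib]
    simp only [Finset.sum_ite_eq', Finset.mem_univ, if_true]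
    ring
  · simp [hl]

lemma charFun_bitSign (t : ℝ) :
    charFun ((PMF.uniformOfFintype Bool).toMeasure.map bitSign) t = Complex.cos t := by
  rw [charFun_apply, integral_map (by fun_prop) (by fun_prop), integral_uniformOfFintype,
    Complex.cos]
  simp [bitSign, Complex.real_smul]
  ring

lemma charFun_cubeWalk (n N : ℕ) (t : EuclideanSpace ℝ (Fin n)) :
    charFun ((PMF.uniformOfFintype (Fin n × Fin N → Bool)).toMeasure.map (cubeWalk n N)) t =
      ∏ i, Complex.cos ((√N)⁻¹ * t i : ℝ) ^ N := by
  have hm : Measurable (cubeWalk n N) := measurable_of_finite _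
  rw [charFun_apply, integral_map hm.aemeasurable (by fun_prop), integral_uniformOfFintype]
  have hcos : ∏ i, Complex.cos ((√N)⁻¹ * t i : ℝ) ^ N = ∏ k : Fin n × Fin N,
      ∑ b : Bool, 2⁻¹ * Complex.exp ((bitSign b * ((√N)⁻¹ * t k.1) : ℝ) * Complex.I) := by
    rw [Fintype.prod_prod_type]
    refine Finset.prod_congr rfl fun i _ ↦ ?_
    dsimp only
    rw [Finset.prod_const, Finset.card_univ, Fintype.card_fin]
    congr 1
    rw [Complex.cos]
    simp [bitSign]
    ring
  rw [hcos, Finset.prod_univ_sum, Fintype.piFinset_univ, Finset.smul_sum]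
  refine Finset.sum_congr rfl fun ω _ ↦ ?_
  rw [Finset.prod_mul_distrib, ← Complex.exp_sum, Finset.prod_const, Complex.real_smul]
  congr 1
  · simp
  · congr 1
    rw [← Finset.sum_mul, ← Complex.ofReal_sum]
    congr 2
    rw [Fintype.sum_prod_type]
    simp only [PiLp.inner_apply, cubeWalk, RCLike.inner_apply, conj_trivial]
    refine Finset.sum_congr rfl fun i _ ↦ ?_
    rw [← Finset.sum_mul]
    ring

lemma tendsto_charFun_cubeWalk (n : ℕ) (t : EuclideanSpace ℝ (Fin n)) :
    Filter.Tendsto (fun N : ℕ ↦ charFun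
      ((PMF.uniformOfFintype (Fin n × Fin N → Bool)).toMeasure.map (cubeWalk n N)) t)
      Filter.atTop (nhds (Complex.exp (-‖t‖ ^ 2 / 2))) := by
  simp_rw [charFun_cubeWalk]
  have h1 (s : ℝ) : Filter.Tendsto (fun N : ℕ ↦ Complex.cos ((√N)⁻¹ * s : ℝ) ^ N)
      Filter.atTop (nhds (Complex.exp (-s ^ 2 / 2))) := by
    have := ProbabilityTheory.tendsto_charFun_inv_sqrt_mul_pow
      (P := (PMF.uniformOfFintype Bool).toMeasure) (X := bitSign) (by fun_prop)
      (by rw [integral_uniformOfFintype]; simp [bitSign])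
      (by rw [integral_uniformOfFintype]; simp [bitSign_sq]) s
    simpa only [charFun_bitSign] using this
  have h2 : Complex.exp (-‖t‖ ^ 2 / 2) = ∏ i, Complex.exp (-(t i) ^ 2 / 2) := by
    rw [← Complex.exp_sum, ← Complex.ofReal_pow, EuclideanSpace.real_norm_sq_eq]
    push_cast
    rw [neg_div, Finset.sum_div, ← Finset.sum_neg_distrib]
    simp [neg_div]
  rw [h2]
  exact tendsto_finsetProd _ fun i _ ↦ h1 (t i)

lemma withDensity_gaussian_eq_stdGaussian (n : ℕ) :
    (volume : Measure (EuclideanSpace ℝ (Fin n))).withDensity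
      (fun x ↦ ENNReal.ofReal ((2 * π) ^ (-(n : ℝ) / 2) * Real.exp (-‖x‖ ^ 2 / 2))) =
      ProbabilityTheory.stdGaussian (EuclideanSpace ℝ (Fin n)) := by
  have hint : Integrable (fun x : EuclideanSpace ℝ (Fin n) ↦
      (2 * π) ^ (-(n : ℝ) / 2) * Real.exp (-‖x‖ ^ 2 / 2)) := by
    refine Integrable.const_mul ?_ _
    have := (GaussianFourier.integrable_cexp_neg_mul_sq_norm_add
      (V := EuclideanSpace ℝ (Fin n)) (b := 1 / 2) (by norm_num) 0 0).re
    refine this.congr (Filter.Eventually.of_forall fun x ↦ ?_)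
    simp only [zero_mul, add_zero]
    rw [show (-(1 / 2 : ℂ)) * (‖x‖ : ℂ) ^ 2 = ((-‖x‖ ^ 2 / 2 : ℝ) : ℂ) by push_cast; ring]
    exact Complex.exp_ofReal_re _
  have : IsFiniteMeasure ((volume : Measure (EuclideanSpace ℝ (Fin n))).withDensity
      (fun x ↦ ENNReal.ofReal ((2 * π) ^ (-(n : ℝ) / 2) * Real.exp (-‖x‖ ^ 2 / 2)))) :=
    isFiniteMeasure_withDensity_ofReal hint.2
  refine Measure.ext_of_charFun ?_
  ext t
  rw [ProbabilityTheory.charFun_stdGaussian, charFun_apply,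
    integral_withDensity_eq_integral_toReal_smul (by fun_prop) (by simp)]
  have h := GaussianFourier.integral_cexp_neg_mul_sq_norm_add
    (V := EuclideanSpace ℝ (Fin n)) (b := 1 / 2) (by norm_num) Complex.I t
  have hfun (x : EuclideanSpace ℝ (Fin n)) :
      (ENNReal.ofReal ((2 * π) ^ (-(n : ℝ) / 2) * Real.exp (-‖x‖ ^ 2 / 2))).toReal •
        Complex.exp (inner ℝ x t * Complex.I) =
      (((2 * π) ^ (-(n : ℝ) / 2) : ℝ) : ℂ) *
        Complex.exp (-(1 / 2) * (‖x‖ : ℂ) ^ 2 + Complex.I * (inner ℝ t x : ℝ)) := by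
    rw [ENNReal.toReal_ofReal (by positivity), Complex.real_smul, Complex.ofReal_mul, mul_assoc,
      Complex.ofReal_exp, ← Complex.exp_add, real_inner_comm]
    congr 2
    push_cast
    ring
  simp_rw [hfun]
  rw [integral_const_mul, h, ← mul_assoc]
  have hc : (((2 * π) ^ (-(n : ℝ) / 2) : ℝ) : ℂ) *
      ((π : ℂ) / (1 / 2)) ^ ((Module.finrank ℝ (EuclideanSpace ℝ (Fin n)) : ℂ) / 2) = 1 := by
    rw [finrank_euclideanSpace_fin, show (π : ℂ) / (1 / 2) = ((2 * π : ℝ) : ℂ) by push_cast; ring,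
      show ((n : ℂ) / 2) = ((n / 2 : ℝ) : ℂ) by push_cast; rfl,
      ← Complex.ofReal_cpow (by positivity), ← Complex.ofReal_mul, ← Real.rpow_add (by positivity)]
    simp [neg_div]
  rw [hc, one_mul, Complex.I_sq]
  congr 1
  ring

lemma abs_sub_sub_fderiv_le_sq {E : Type*} [NormedAddCommGroup E] [NormedSpace ℝ E] {f : E → ℝ}
    {C : ℝ} (hf : ContDiff ℝ 2 f) (hC : ∀ x, ‖iteratedFDeriv ℝ 2 f x‖ ≤ C) (x v : E) :
    |f (x + v) - f x - fderiv ℝ f x v| ≤ C * ‖v‖ ^ 2 := by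
  have hf' : Differentiable ℝ (fderiv ℝ f) :=
    (hf.fderiv_right (m := 1) (by norm_num)).differentiable (by norm_num)
  have hC0 : 0 ≤ C := (norm_nonneg _).trans (hC 0)
  have hlip (y : E) : ‖fderiv ℝ f y - fderiv ℝ f x‖ ≤ C * ‖y - x‖ :=
    convex_univ.norm_image_sub_le_of_norm_fderiv_le (𝕜 := ℝ) (fun z _ ↦ hf' z)
      (fun z _ ↦ by
        rw [← norm_iteratedFDeriv_one, norm_iteratedFDeriv_fderiv]
        exact hC z) (Set.mem_univ _) (Set.mem_univ _)
  have := (convex_closedBall x ‖v‖).norm_image_sub_le_of_norm_fderiv_le' (𝕜 := ℝ) (f := f)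
    (C := C * ‖v‖) (x := x) (y := x + v) (φ := fderiv ℝ f x)
    (fun y _ ↦ hf.differentiable (by norm_num) y)
    (fun y hy ↦ (hlip y).trans <| mul_le_mul_of_nonneg_left (mem_closedBall_iff_norm.1 hy) hC0)
    (by simp) (by simp)
  rw [add_sub_cancel_left, Real.norm_eq_abs] at this
  linarith

lemma sum_sq_apply_single {n : ℕ} (L : EuclideanSpace ℝ (Fin n) →L[ℝ] ℝ) :
    ∑ i, L (EuclideanSpace.single i 1) ^ 2 = ‖L‖ ^ 2 := by
  obtain ⟨w, rfl⟩ := (InnerProductSpace.toDual ℝ (EuclideanSpace ℝ (Fin n))).surjective L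
  rw [LinearIsometryEquiv.norm_map, EuclideanSpace.real_norm_sq_eq]
  simp [InnerProductSpace.toDual_apply_apply, EuclideanSpace.inner_single_right]

lemma exists_abs_sum_sq_sub_norm_fderiv_sq_le {n : ℕ} {f : EuclideanSpace ℝ (Fin n) → ℝ}
    {C₁ C₂ : ℝ} (hf : ContDiff ℝ 2 f) (h₁ : ∀ x, ‖fderiv ℝ f x‖ ≤ C₁)
    (h₂ : ∀ x, ‖iteratedFDeriv ℝ 2 f x‖ ≤ C₂) :
    ∃ C, ∀ N : ℕ, 0 < N → ∀ ω : Fin n × Fin N → Bool,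
      |∑ k, ((f (cubeWalk n N ω) - f (cubeWalk n N (Function.update ω k (!ω k)))) / 2) ^ 2 -
        ‖fderiv ℝ f (cubeWalk n N ω)‖ ^ 2| ≤ C * (√N)⁻¹ := by
  refine ⟨n * (4 * C₁ * C₂ + 4 * C₂ ^ 2), fun N hN ω ↦ ?_⟩
  have hC₁ : 0 ≤ C₁ := (norm_nonneg _).trans (h₁ 0)
  have hC₂ : 0 ≤ C₂ := (norm_nonneg _).trans (h₂ 0)
  set x := cubeWalk n N ω with hx
  set L := fderiv ℝ f x with hL
  set h : ℝ := (√N)⁻¹ with hh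
  have hN' : (1 : ℝ) ≤ N := by exact_mod_cast hN
  have hpos : 0 < h := by positivity
  have hle : h ≤ 1 := inv_le_one_of_one_le₀ (Real.one_le_sqrt.2 hN')
  have hsq : N * h ^ 2 = 1 := by
    rw [hh, inv_pow, Real.sq_sqrt (by positivity)]
    exact mul_inv_cancel₀ (by positivity)
  have hmain : ‖L‖ ^ 2 = ∑ k : Fin n × Fin N, h ^ 2 * L (EuclideanSpace.single k.1 1) ^ 2 := by
    rw [Fintype.sum_prod_type, ← sum_sq_apply_single]
    refine Finset.sum_congr rfl fun i _ ↦ ?_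
    simp only [Finset.sum_const, Finset.card_univ, Fintype.card_fin, nsmul_eq_mul]
    rw [← mul_assoc, hsq, one_mul]
  have hterm (k : Fin n × Fin N) :
      |((f x - f (cubeWalk n N (Function.update ω k (!ω k)))) / 2) ^ 2 -
        h ^ 2 * L (EuclideanSpace.single k.1 1) ^ 2| ≤ (4 * C₁ * C₂ + 4 * C₂ ^ 2) * h ^ 3 := by
    rw [cubeWalk_update, ← hx, ← hh]
    set e : EuclideanSpace ℝ (Fin n) := EuclideanSpace.single k.1 1
    have he : ‖e‖ = 1 := by simp [e]
    set σ := bitSign (ω k)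
    have hσ : σ ^ 2 = 1 := bitSign_sq _
    have hσ' : |σ| = 1 := by rw [← sq_eq_sq₀ (abs_nonneg _) zero_le_one, sq_abs, hσ, one_pow]
    have hT := abs_sub_sub_fderiv_le_sq hf h₂ x (-((2 * h * σ) • e))
    rw [← sub_eq_add_neg, norm_neg, norm_smul, he, mul_one, Real.norm_eq_abs, sq_abs, map_neg,
      map_smul, ← hL, smul_eq_mul] at hT
    have hLe : |L e| ≤ C₁ := by
      simpa [he] using (L.le_opNorm e).trans (mul_le_mul_of_nonneg_right (h₁ x) (norm_nonneg e))
    obtain ⟨R, hR⟩ : ∃ R, R = f (x - (2 * h * σ) • e) - f x - -(2 * h * σ * L e) := ⟨_, rfl⟩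
    rw [← hR] at hT
    have hR' : |R| ≤ 4 * C₂ * h ^ 2 := hT.trans_eq (by rw [mul_pow, hσ]; ring)
    have heq : ((f x - f (x - (2 * h * σ) • e)) / 2) ^ 2 - h ^ 2 * L e ^ 2 =
        R ^ 2 / 4 - h * σ * L e * R := by
      rw [show f (x - (2 * h * σ) • e) = R + f x - 2 * h * σ * L e by rw [hR]; ring]
      linear_combination h ^ 2 * L e ^ 2 * hσ
    rw [heq]
    have hA : |R ^ 2 / 4| ≤ 4 * C₂ ^ 2 * h ^ 4 := by
      rw [abs_div, abs_pow, abs_of_pos (by norm_num : (0 : ℝ) < 4)]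
      have := pow_le_pow_left₀ (abs_nonneg R) hR' 2
      linarith
    have hB : |h * σ * L e * R| ≤ 4 * C₁ * C₂ * h ^ 3 := by
      rw [abs_mul, abs_mul, abs_mul, hσ', mul_one, abs_of_pos hpos]
      calc h * |L e| * |R| ≤ h * C₁ * (4 * C₂ * h ^ 2) := by gcongr
        _ = _ := by ring
    have hC : h ^ 4 ≤ h ^ 3 := pow_le_pow_of_le_one hpos.le hle (by norm_num)
    have hD : 4 * C₂ ^ 2 * h ^ 4 ≤ 4 * C₂ ^ 2 * h ^ 3 := by gcongr
    exact (abs_sub _ _).trans (by linarith)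
  rw [hmain, ← Finset.sum_sub_distrib]
  refine (Finset.abs_sum_le_sum_abs _ _).trans ((Finset.sum_le_sum fun k _ ↦ hterm k).trans_eq ?_)
  simp only [Finset.sum_const, Finset.card_univ, Fintype.card_prod, Fintype.card_fin,
    nsmul_eq_mul, Nat.cast_mul]
  linear_combination n * (4 * C₁ * C₂ + 4 * C₂ ^ 2) * h * hsq

lemma tendsto_expect_cubeWalk {n : ℕ} {g : EuclideanSpace ℝ (Fin n) → ℝ} (hg : Continuous g)
    {C : ℝ} (hC : ∀ x, |g x| ≤ C) :
    Filter.Tendsto (fun N : ℕ ↦ 𝔼 ω, g (cubeWalk n N ω)) Filter.atTop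
      (nhds (∫ x, g x ∂ProbabilityTheory.stdGaussian (EuclideanSpace ℝ (Fin n)))) := by
  have hm (N : ℕ) : Measurable (cubeWalk n N) := measurable_of_finite _
  let P (N : ℕ) : ProbabilityMeasure (EuclideanSpace ℝ (Fin n)) :=
    ⟨(PMF.uniformOfFintype (Fin n × Fin N → Bool)).toMeasure.map (cubeWalk n N),
      Measure.isProbabilityMeasure_map (hm N).aemeasurable⟩
  let Q : ProbabilityMeasure (EuclideanSpace ℝ (Fin n)) :=
    ⟨ProbabilityTheory.stdGaussian _, inferInstance⟩
  have hPQ : Filter.Tendsto P Filter.atTop (nhds Q) :=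
    ProbabilityMeasure.tendsto_of_tendsto_charFun fun t ↦ by
      simpa only [P, Q, ProbabilityMeasure.coe_mk, ProbabilityTheory.charFun_stdGaussian]
        using tendsto_charFun_cubeWalk n t
  have := ProbabilityMeasure.tendsto_iff_forall_integral_tendsto.1 hPQ
    (BoundedContinuousFunction.ofNormedAddCommGroup g hg C hC)
  refine this.congr fun N ↦ ?_
  simp only [P, ProbabilityMeasure.coe_mk, BoundedContinuousFunction.coe_ofNormedAddCommGroup]
  rw [integral_map (hm N).aemeasurable hg.aestronglyMeasurable, integral_uniformOfFintype,
    Fintype.expect_eq_sum_div_card, smul_eq_mul, div_eq_inv_mul]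

/-- The improved `3/2`-Beckner inequality for the standard Gaussian measure. -/
theorem integral_becknerFun_stdGaussian_le {n : ℕ} {f : EuclideanSpace ℝ (Fin n) → ℝ}
    {C₀ C₁ C₂ : ℝ} (hf : ContDiff ℝ 2 f) (hpos : ∀ x, 0 ≤ f x) (h₀ : ∀ x, f x ≤ C₀)
    (h₁ : ∀ x, ‖fderiv ℝ f x‖ ≤ C₁) (h₂ : ∀ x, ‖iteratedFDeriv ℝ 2 f x‖ ≤ C₂) :
    Integrable (fun x ↦ becknerFun (f x) (‖fderiv ℝ f x‖ ^ 2))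
      (ProbabilityTheory.stdGaussian (EuclideanSpace ℝ (Fin n))) ∧
    ∫ x, becknerFun (f x) (‖fderiv ℝ f x‖ ^ 2)
        ∂ProbabilityTheory.stdGaussian (EuclideanSpace ℝ (Fin n)) ≤
      (∫ x, f x ∂ProbabilityTheory.stdGaussian (EuclideanSpace ℝ (Fin n))) ^ (3 / 2 : ℝ) := by
  obtain ⟨C, hC⟩ := exists_abs_sum_sq_sub_norm_fderiv_sq_le hf h₁ h₂
  have hC₁ : 0 ≤ C₁ := (norm_nonneg _).trans (h₁ 0)
  set K : Set (ℝ × ℝ) := Set.Icc 0 (C₀ + 1) ×ˢ Set.Icc (-1) (C₁ ^ 2 + 1)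
  have hK : IsCompact K := isCompact_Icc.prod isCompact_Icc
  have hmem (x) : (f x, ‖fderiv ℝ f x‖ ^ 2) ∈ K :=
    ⟨⟨hpos x, by linarith [h₀ x]⟩, by linarith [sq_nonneg ‖fderiv ℝ f x‖],
      by linarith [pow_le_pow_left₀ (norm_nonneg _) (h₁ x) 2]⟩
  have hgc : Continuous fun x ↦ becknerFun (f x) (‖fderiv ℝ f x‖ ^ 2) :=
    continuous_becknerFun.comp
      (hf.continuous.prodMk ((hf.continuous_fderiv (by norm_num)).norm.pow 2))
  obtain ⟨B, hB⟩ := hK.exists_bound_of_continuousOn continuous_becknerFun.continuousOn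
  have hgB (x) : |becknerFun (f x) (‖fderiv ℝ f x‖ ^ 2)| ≤ B := hB _ (hmem x)
  refine ⟨Integrable.of_bound hgc.aestronglyMeasurable B (.of_forall hgB), ?_⟩
  have hlim₁ := tendsto_expect_cubeWalk hgc hgB
  have hlim₂ := tendsto_expect_cubeWalk hf.continuous (C := C₀)
    fun x ↦ by rw [abs_of_nonneg (hpos x)]; exact h₀ x
  have hinv : Filter.Tendsto (fun N : ℕ ↦ (√(N : ℝ))⁻¹) Filter.atTop (nhds 0) :=
    tendsto_inv_atTop_zero.comp (Real.tendsto_sqrt_atTop.comp tendsto_natCast_atTop_atTop)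
  have hCinv : Filter.Tendsto (fun N : ℕ ↦ C * (√(N : ℝ))⁻¹) Filter.atTop (nhds 0) := by
    simpa using hinv.const_mul C
  refine le_of_forall_pos_sub_le fun ε hε ↦ ?_
  obtain ⟨δ, hδ, hunif⟩ := Metric.uniformContinuousOn_iff.1
    (hK.uniformContinuousOn_of_continuous continuous_becknerFun.continuousOn) ε hε
  have hlim₃ : Filter.Tendsto (fun N : ℕ ↦ (𝔼 ω, f (cubeWalk n N ω) + (√(N : ℝ))⁻¹) ^ (3 / 2 : ℝ))
      Filter.atTop (nhds ((∫ x, f x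
        ∂ProbabilityTheory.stdGaussian (EuclideanSpace ℝ (Fin n))) ^ (3 / 2 : ℝ))) := by
    have := (hlim₂.add hinv).rpow_const (p := (3 / 2 : ℝ)) (Or.inr (by norm_num))
    simpa only [add_zero] using this
  refine le_of_tendsto_of_tendsto (hlim₁.sub_const ε) hlim₃ ?_
  filter_upwards [Filter.eventually_gt_atTop 0, hinv.eventually_lt_const (lt_min hδ one_pos),
    hCinv.eventually_lt_const (lt_min hδ one_pos)] with N hN hN₁ hN₂
  rw [lt_min_iff] at hN₁ hN₂
  have hNpos : 0 < (√(N : ℝ))⁻¹ := by positivity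
  have hcube := expect_becknerFun_cube_le (Fin n × Fin N)
    (fun ω ↦ f (cubeWalk n N ω) + (√(N : ℝ))⁻¹) fun ω ↦ by linarith [hpos (cubeWalk n N ω)]
  simp only [add_sub_add_right_eq_sub] at hcube
  rw [Finset.expect_add_distrib, Fintype.expect_const] at hcube
  refine le_trans ?_ hcube
  rw [← Fintype.expect_const (ι := Fin n × Fin N → Bool) ε, ← Finset.expect_sub_distrib]
  refine Finset.expect_le_expect fun ω _ ↦ ?_
  have hq := hC N hN ω
  set q := ∑ k, ((f (cubeWalk n N ω) - f (cubeWalk n N (Function.update ω k (!ω k)))) / 2) ^ 2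
  have hq' := abs_le.1 hq
  have hm := hmem (cubeWalk n N ω)
  have hm' : (f (cubeWalk n N ω) + (√(N : ℝ))⁻¹, q) ∈ K :=
    ⟨⟨by linarith [hm.1.1], by linarith [h₀ (cubeWalk n N ω)]⟩,
      by linarith [hq'.1, sq_nonneg ‖fderiv ℝ f (cubeWalk n N ω)‖],
      by linarith [hq'.2, pow_le_pow_left₀ (norm_nonneg _) (h₁ (cubeWalk n N ω)) 2]⟩
  have hd := hunif _ hm _ hm' (by
    rw [Prod.dist_eq, max_lt_iff, dist_comm, dist_comm _ q, Real.dist_eq, Real.dist_eq]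
    refine ⟨?_, lt_of_le_of_lt hq hN₂.1⟩
    rw [add_sub_cancel_left, abs_of_pos hNpos]
    exact hN₁.1)
  rw [Real.dist_eq] at hd
  linarith [(abs_lt.1 hd).2]

/-- the improved 3/2-Beckner inequality for the standard Gaussian
measure `γ` on `ℝⁿ`:
`∫ f^{3/2} dγ − (∫ f dγ)^{3/2} ≤ ∫ [f^{3/2} − (1/√2)(2f − √(f²+‖∇f‖²))√(f+√(f²+‖∇f‖²))] dγ`,
equivalently
`∫ (1/√2)(2f − √(f²+‖∇f‖²))√(f+√(f²+‖∇f‖²)) dγ ≤ (∫ f dγ)^{3/2}`. -/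
theorem stmt_14 (n : ℕ) (γ : Measure (EuclideanSpace ℝ (Fin n)))
    (hγ : γ = volume.withDensity
      (fun x => ENNReal.ofReal ((2 * π) ^ (-(n : ℝ) / 2) * Real.exp (-‖x‖ ^ 2 / 2))))
    (f : EuclideanSpace ℝ (Fin n) → ℝ)
    (hf : ContDiff ℝ (⊤ : ℕ∞) f)
    (hpos : ∀ x, 0 ≤ f x)
    (hfd : ∀ i : ℕ, ∃ C : ℝ, ∀ x, ‖iteratedFDeriv ℝ i f x‖ ≤ C) :
    (∫ x, (f x) ^ ((3 : ℝ) / 2) ∂γ - (∫ x, f x ∂γ) ^ ((3 : ℝ) / 2)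
        ≤ ∫ x, ((f x) ^ ((3 : ℝ) / 2)
            - 1 / Real.sqrt 2 * (2 * f x - Real.sqrt ((f x) ^ 2 + ‖fderiv ℝ f x‖ ^ 2))
              * Real.sqrt (f x + Real.sqrt ((f x) ^ 2 + ‖fderiv ℝ f x‖ ^ 2))) ∂γ) ∧
      (∫ x, 1 / Real.sqrt 2 * (2 * f x - Real.sqrt ((f x) ^ 2 + ‖fderiv ℝ f x‖ ^ 2))
            * Real.sqrt (f x + Real.sqrt ((f x) ^ 2 + ‖fderiv ℝ f x‖ ^ 2)) ∂γ
        ≤ (∫ x, f x ∂γ) ^ ((3 : ℝ) / 2)) := by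
  obtain ⟨C₀, h₀⟩ := hfd 0
  obtain ⟨C₁, h₁⟩ := hfd 1
  obtain ⟨C₂, h₂⟩ := hfd 2
  simp only [norm_iteratedFDeriv_zero, Real.norm_eq_abs] at h₀
  simp only [norm_iteratedFDeriv_one] at h₁
  have h₀' (x) : f x ≤ C₀ := (le_abs_self _).trans (h₀ x)
  rw [hγ, withDensity_gaussian_eq_stdGaussian]
  obtain ⟨hint, hle⟩ := integral_becknerFun_stdGaussian_le (by exact_mod_cast contDiff_infty.1 hf 2)
    hpos h₀' h₁ h₂
  simp only [becknerFun] at hint hle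
  refine ⟨?_, hle⟩
  have hint' : Integrable (fun x ↦ f x ^ ((3 : ℝ) / 2))
      (ProbabilityTheory.stdGaussian (EuclideanSpace ℝ (Fin n))) := by
    refine Integrable.of_bound
      (hf.continuous.rpow_const fun x ↦ Or.inr (by norm_num)).aestronglyMeasurable
      (C₀ ^ ((3 : ℝ) / 2)) (.of_forall fun x ↦ ?_)
    rw [Real.norm_of_nonneg (Real.rpow_nonneg (hpos x) _)]
    exact Real.rpow_le_rpow (hpos x) (h₀' x) (by norm_num)
  rw [integral_sub hint' hint]
  exact sub_le_sub_left hle _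
end

section
/- For every smooth bounded nonnegative function f : ℝⁿ → [0,∞) with bounded derivatives, ∫_{ℝⁿ} f^{3/2} dγ − (∫_{ℝⁿ} f dγ)^{3/2} ≤ (1/√2) ∫_{ℝⁿ} ‖∇f‖^{3/2} dγ, where γ is the standard Gaussian measure on ℝⁿ. -/
open MeasureTheory Real

open Filter Topology

lemma add_sq_div_add_le {α β : ℝ} (hα : 0 < α) (hβ : 0 < β) (u w : ℝ) :
    (u + w) ^ 2 / (α + β) ≤ u ^ 2 / α + w ^ 2 / β := by
  rw [div_add_div _ _ hα.ne' hβ.ne', div_le_div_iff₀ (by positivity) (by positivity)]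
  nlinarith [mul_nonneg (mul_pos hα hβ).le (sq_nonneg (β * u - α * w)), sq_nonneg (β * u - α * w)]

/-- For fixed `α > 0`, a minorant of `Re (x + i √s) ^ (3 / 2)` which is affine in `x` and in `s`;
the supremum over `α` is `Re (x + i √s) ^ (3 / 2)`. -/
noncomputable def minorant (x s α : ℝ) : ℝ :=
  3 / 2 * (α * x) - α ^ 3 / 2 - 3 / 8 * (s / α)

lemma minorant_two_point {ι : Type*} (t : Finset ι) {α β : ℝ} (hα : 0 < α) (hβ : 0 < β)
    (x y : ℝ) (u w : ι → ℝ) :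
    (minorant x (((x - y) / 2) ^ 2 + ∑ i ∈ t, u i ^ 2) α +
      minorant y (((y - x) / 2) ^ 2 + ∑ i ∈ t, w i ^ 2) β) / 2 ≤
    minorant ((x + y) / 2) (∑ i ∈ t, ((u i + w i) / 2) ^ 2) ((α + β) / 2) := by
  have hs : (∑ i ∈ t, ((u i + w i) / 2) ^ 2) / ((α + β) / 2) ≤
      ((∑ i ∈ t, u i ^ 2) / α + (∑ i ∈ t, w i ^ 2) / β) / 2 := by
    simp only [Finset.sum_div, ← Finset.sum_add_distrib]
    refine Finset.sum_le_sum fun i _ ↦ ?_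
    have := add_sq_div_add_le hα hβ (u i) (w i)
    calc ((u i + w i) / 2) ^ 2 / ((α + β) / 2) = (u i + w i) ^ 2 / (α + β) / 2 := by
          field_simp
      _ ≤ _ := by gcongr
  have hd := add_sq_div_add_le hα hβ ((x - y) / 2) ((x - y) / 2)
  have hp : 0 ≤ ((x - y) - (α + β) * (α - β)) ^ 2 / (α + β) := by positivity
  have hp' : ((x - y) - (α + β) * (α - β)) ^ 2 / (α + β) =
      ((x - y) / 2 + (x - y) / 2) ^ 2 / (α + β) - 2 * (x - y) * (α - β)
        + (α + β) * (α - β) ^ 2 := by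
    field_simp; ring
  have e : ((y - x) / 2) ^ 2 = ((x - y) / 2) ^ 2 := by ring
  unfold minorant
  rw [e, add_div _ _ α, add_div _ _ β]
  nlinarith

/-- The mean of a function on the discrete cube. -/
noncomputable def cubeAvg {N : ℕ} (F : (Fin N → Bool) → ℝ) : ℝ := (∑ ω, F ω) / 2 ^ N

lemma cubeAvg_mono {N : ℕ} {F G : (Fin N → Bool) → ℝ} (h : ∀ ω, F ω ≤ G ω) :
    cubeAvg F ≤ cubeAvg G := by
  unfold cubeAvg
  gcongr with ω
  exact h ω

lemma cubeAvg_succ {N : ℕ} (F : (Fin (N + 1) → Bool) → ℝ) :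
    cubeAvg F = cubeAvg fun ω : Fin N → Bool ↦
      (F (Fin.cons true ω) + F (Fin.cons false ω)) / 2 := by
  unfold cubeAvg
  rw [← (Fin.consEquiv fun _ : Fin (N + 1) ↦ Bool).sum_comp, Fintype.sum_prod_type_right,
    ← Finset.sum_div, div_div, pow_succ']
  simp [Fin.consEquiv]

/-- Half the increment of a function on the discrete cube along a coordinate. -/
noncomputable def cubeDiff {N : ℕ} (f : (Fin N → Bool) → ℝ) (i : Fin N) (ω : Fin N → Bool) : ℝ :=
  (f ω - f (Function.update ω i (!ω i))) / 2

/-- The inequality on the discrete cube, by induction from the two-point inequality. -/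
theorem cubeAvg_minorant_le {N : ℕ} (f α : (Fin N → Bool) → ℝ) (hα : ∀ ω, 0 < α ω) :
    cubeAvg (fun ω ↦ minorant (f ω) (∑ i, cubeDiff f i ω ^ 2) (α ω)) ≤
      minorant (cubeAvg f) 0 (cubeAvg α) := by
  induction N with
  | zero => simp [cubeAvg]
  | succ N ih =>
    rw [cubeAvg_succ, cubeAvg_succ f, cubeAvg_succ α]
    refine le_trans (cubeAvg_mono fun ω ↦ ?_)
      (ih _ _ fun ω ↦ half_pos (add_pos (hα (Fin.cons true ω)) (hα (Fin.cons false ω))))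
    have h := minorant_two_point Finset.univ (hα (Fin.cons true ω)) (hα (Fin.cons false ω))
      (f (Fin.cons true ω)) (f (Fin.cons false ω)) (fun i : Fin N ↦ cubeDiff f i.succ (Fin.cons true ω))
      (fun i : Fin N ↦ cubeDiff f i.succ (Fin.cons false ω))
    convert! h using 4
    · simp [Fin.sum_univ_succ, cubeDiff]
    · simp [Fin.sum_univ_succ, cubeDiff]
    · simp only [cubeDiff, Fin.cons_succ, Fin.cons_update]
      ring

lemma minorant_zero_le {x α : ℝ} (hx : 0 ≤ x) (hα : 0 ≤ α) :
    minorant x 0 α ≤ x ^ ((3 : ℝ) / 2) := by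
  obtain ⟨s, hs, rfl⟩ : ∃ s : ℝ, 0 ≤ s ∧ s ^ 2 = x := ⟨√x, by positivity, sq_sqrt hx⟩
  have e : (s ^ 2) ^ ((3 : ℝ) / 2) = s ^ 3 := by
    rw [← rpow_natCast, ← rpow_mul hs, ← rpow_natCast]; norm_num
  rw [e]
  simp only [minorant, zero_div, mul_zero, sub_zero]
  nlinarith [mul_nonneg (add_nonneg hα (add_nonneg hs hs)) (sq_nonneg (α - s))]

lemma le_minorant_sqrt {x y : ℝ} (hx : 0 < x) (hy : 0 ≤ y) :
    x ^ ((3 : ℝ) / 2) - 1 / √2 * y ^ ((3 : ℝ) / 2) ≤ minorant x (y ^ 2) √(x + y / 2) := by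
  obtain ⟨p, hp, rfl⟩ : ∃ s : ℝ, 0 < s ∧ s ^ 2 = x := ⟨√x, by positivity, sq_sqrt hx.le⟩
  obtain ⟨q, hq, rfl⟩ : ∃ s : ℝ, 0 ≤ s ∧ 2 * s ^ 2 = y :=
    ⟨√(y / 2), by positivity, by rw [sq_sqrt (by positivity)]; ring⟩
  have e {s : ℝ} (hs : 0 ≤ s) : (s ^ 2) ^ ((3 : ℝ) / 2) = s ^ 3 := by
    rw [← rpow_natCast, ← rpow_mul hs, ← rpow_natCast]; norm_num
  have e2 : (2 : ℝ) ^ ((3 : ℝ) / 2) = √2 ^ 3 := by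
    rw [← e (sqrt_nonneg 2), sq_sqrt (by norm_num)]
  have e3 : 1 / √2 * √2 ^ 3 = 2 := by
    have : √2 ≠ 0 := by positivity
    field_simp
    norm_num
  rw [mul_rpow (by norm_num) (by positivity), e hp.le, e hq, e2, ← mul_assoc, e3,
    mul_div_cancel_left₀ _ two_ne_zero]
  set s := √(p ^ 2 + q ^ 2)
  have hs0 : 0 < s := by positivity
  have hs2 : s ^ 2 = p ^ 2 + q ^ 2 := sq_sqrt (by positivity)
  have hqs : q ≤ s := by nlinarith
  have key : minorant (p ^ 2) ((2 * q ^ 2) ^ 2) s =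
      (p ^ 4 + p ^ 2 * q ^ 2 / 2 - 2 * q ^ 4) / s := by
    unfold minorant
    rw [eq_div_iff hs0.ne']
    have : 3 / 8 * ((2 * q ^ 2) ^ 2 / s) * s = 3 / 2 * q ^ 4 := by field_simp; ring
    rw [sub_mul, this]
    linear_combination (3 / 2 * p ^ 2 - (s ^ 2 + p ^ 2 + q ^ 2) / 2) * hs2
  rw [key, le_div_iff₀ hs0]
  have h1 : p * s ≤ p ^ 2 + q ^ 2 / 2 := by nlinarith [sq_nonneg (p - s)]
  have h2 := mul_le_mul_of_nonneg_left h1 (sq_nonneg p)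
  have h3 := mul_le_mul_of_nonneg_left hqs (pow_nonneg hq 3)
  nlinarith

/-- The signed sum of the vectors `v j` with signs given by `ω`. -/
noncomputable def signedSum {N : ℕ} {E : Type*} [AddCommGroup E] (v : Fin N → E)
    (ω : Fin N → Bool) : E := ∑ j, if ω j then v j else -v j

lemma signedSum_update {N : ℕ} {E : Type*} [AddCommGroup E] (v : Fin N → E)
    (ω : Fin N → Bool) (j : Fin N) :
    signedSum v (Function.update ω j (!ω j)) =
      signedSum v ω - 2 • (if ω j then v j else -v j) := by
  unfold signedSum
  rw [← Finset.add_sum_erase _ _ (Finset.mem_univ j),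
    ← Finset.add_sum_erase Finset.univ (fun j ↦ if ω j then v j else -v j) (Finset.mem_univ j)]
  have : ∑ i ∈ Finset.univ.erase j, (if Function.update ω j (!ω j) i then v i else -v i) =
      ∑ i ∈ Finset.univ.erase j, (if ω i then v i else -v i) :=
    Finset.sum_congr rfl fun i hi ↦ by rw [Function.update_of_ne (Finset.ne_of_mem_erase hi)]
  rw [this, Function.update_self]
  cases ω j <;> simp only [Bool.not_true, Bool.not_false] <;> simp [two_nsmul] <;> abel

/-- The law of the sum of the vectors `v j` with independent uniform random signs. -/
noncomputable def signedSumLaw {N : ℕ} {E : Type*} [AddCommGroup E] [MeasurableSpace E]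
    (v : Fin N → E) : Measure E :=
  (2 ^ N : ENNReal)⁻¹ • ∑ ω, Measure.dirac (signedSum v ω)

instance {N : ℕ} {E : Type*} [AddCommGroup E] [MeasurableSpace E] (v : Fin N → E) :
    IsProbabilityMeasure (signedSumLaw v) where
  measure_univ := by
    simp only [signedSumLaw, Measure.smul_apply, Measure.finsetSum_apply, measure_univ]
    simp [ENNReal.inv_mul_cancel]

lemma integral_signedSumLaw {N : ℕ} {E G : Type*} [AddCommGroup E] [MeasurableSpace E]
    [MeasurableSingletonClass E] [NormedAddCommGroup G] [NormedSpace ℝ G] [CompleteSpace G]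
    (v : Fin N → E) (F : E → G) :
    ∫ x, F x ∂signedSumLaw v = (2 ^ N : ℝ)⁻¹ • ∑ ω, F (signedSum v ω) := by
  rw [signedSumLaw, integral_smul_measure, integral_finsetSum_measure]
  · simp
  · exact fun ω _ ↦ integrable_dirac (by simp)

lemma charFun_signedSumLaw {N : ℕ} {E : Type*} [NormedAddCommGroup E] [InnerProductSpace ℝ E]
    [MeasurableSpace E] [MeasurableSingletonClass E] (v : Fin N → E) (t : E) :
    charFun (signedSumLaw v) t = ∏ j, (cos (inner ℝ (v j) t) : ℂ) := by
  rw [charFun_apply, integral_signedSumLaw]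
  have h (ω : Fin N → Bool) : Complex.exp (inner ℝ (signedSum v ω) t * Complex.I) =
      ∏ j, Complex.exp ((if ω j then inner ℝ (v j) t else -inner ℝ (v j) t : ℝ) * Complex.I) := by
    rw [signedSum, sum_inner, ← Complex.exp_sum, Complex.ofReal_sum, Finset.sum_mul]
    congr! 4 with j
    split_ifs <;> simp
  have hp := Finset.prod_univ_sum (fun _ : Fin N ↦ (Finset.univ : Finset Bool))
    (fun j b ↦ Complex.exp ((if b then inner ℝ (v j) t else -inner ℝ (v j) t : ℝ) * Complex.I))
  rw [Fintype.piFinset_univ] at hp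
  simp_rw [h, ← hp]
  have h2 (j : Fin N) : (cos (inner ℝ (v j) t) : ℂ) = 2⁻¹ * ∑ b : Bool,
      Complex.exp ((if b then inner ℝ (v j) t else -inner ℝ (v j) t : ℝ) * Complex.I) := by
    rw [Complex.ofReal_cos, Complex.cos]
    simp
    ring
  simp_rw [h2, Finset.prod_mul_distrib]
  simp

lemma tendsto_cos_pow (t : ℝ) :
    Tendsto (fun m : ℕ ↦ cos ((√m)⁻¹ * t) ^ m) atTop (𝓝 (exp (-t ^ 2 / 2))) := by
  have key : Tendsto (fun m : ℕ ↦ (cos ((√m)⁻¹ * t) : ℂ) ^ m) atTop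
      (𝓝 (Complex.exp ((-t ^ 2 / 2 : ℝ)))) := by
    apply Complex.tendsto_pow_exp_of_isLittleO_sub_add_div
    have h0 : Tendsto (fun m : ℕ ↦ (√m)⁻¹ * t) atTop (𝓝 0) := by
      rw [← zero_mul t]
      exact .mul_const t (tendsto_inv_atTop_zero.comp <| Real.tendsto_sqrt_atTop.comp <|
        tendsto_natCast_atTop_atTop)
    have h1 : Tendsto (fun m : ℕ ↦ (m : ℝ)⁻¹ * (t ^ 4 * (5 / 96))) atTop (𝓝 0) := by
      rw [← zero_mul (t ^ 4 * (5 / 96))]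
      exact .mul_const _ (tendsto_inv_atTop_zero.comp tendsto_natCast_atTop_atTop)
    rw [Asymptotics.isLittleO_iff]
    intro c hc
    have h2 : ∀ᶠ m : ℕ in atTop, |(√m)⁻¹ * t| ≤ 1 := by
      have := h0.abs
      rw [abs_zero] at this
      exact this.eventually_le_const zero_lt_one
    filter_upwards [h2, h1.eventually_le_const hc, eventually_gt_atTop 0] with m hm hm' hpos
    have hm0 : (0 : ℝ) < m := by exact_mod_cast hpos
    have hsq : ((√m)⁻¹ * t) ^ 2 = t ^ 2 / m := by
      rw [mul_pow, inv_pow, sq_sqrt hm0.le]; ring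
    have hb := Real.cos_bound hm
    rw [show |(√m)⁻¹ * t| ^ 4 = (((√m)⁻¹ * t) ^ 2) ^ 2 by
      rw [← pow_mul, ← abs_pow, abs_of_nonneg (by positivity)], hsq] at hb
    have e : (cos ((√m)⁻¹ * t) : ℂ) - (1 + ((-t ^ 2 / 2 : ℝ) : ℂ) / m) =
        ((cos ((√m)⁻¹ * t) - (1 - t ^ 2 / m / 2) : ℝ) : ℂ) := by
      push_cast; ring
    have e2 : ‖(1 / (m : ℂ))‖ = (m : ℝ)⁻¹ := by simp
    rw [e, e2, Complex.norm_real, norm_eq_abs]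
    calc _ ≤ _ := hb
      _ = ((m : ℝ)⁻¹ * (t ^ 4 * (5 / 96))) * (m : ℝ)⁻¹ := by field_simp
      _ ≤ _ := by gcongr
  have := (Complex.continuous_re.tendsto _).comp key
  rw [Complex.exp_ofReal_re] at this
  refine this.congr fun m ↦ ?_
  simp only [Function.comp_apply]
  rw [← Complex.ofReal_pow, Complex.ofReal_re]

/-- `m` copies of the standard basis of `ℝⁿ`, scaled by `1 / √m`. -/
noncomputable def scaledBasis (n m : ℕ) (j : Fin (m * n)) : EuclideanSpace ℝ (Fin n) :=
  (√m)⁻¹ • EuclideanSpace.basisFun (Fin n) ℝ (finProdFinEquiv.symm j).2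

lemma tendsto_charFun_scaledBasis {n : ℕ} (t : EuclideanSpace ℝ (Fin n)) :
    Tendsto (fun m ↦ charFun (signedSumLaw (scaledBasis n m)) t) atTop
      (𝓝 (exp (-‖t‖ ^ 2 / 2) : ℝ)) := by
  have h (m : ℕ) : charFun (signedSumLaw (scaledBasis n m)) t =
      ((∏ i, cos ((√m)⁻¹ * t i) ^ m : ℝ) : ℂ) := by
    rw [charFun_signedSumLaw, ← finProdFinEquiv.prod_comp, Fintype.prod_prod_type_right]
    push_cast
    refine Finset.prod_congr rfl fun i _ ↦ ?_
    simp [scaledBasis, inner_smul_left, EuclideanSpace.inner_single_left]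
  simp_rw [h]
  refine (Complex.continuous_ofReal.tendsto _).comp ?_
  have e : exp (-‖t‖ ^ 2 / 2) = ∏ i, exp (-t i ^ 2 / 2) := by
    rw [← exp_sum, EuclideanSpace.real_norm_sq_eq, ← Finset.sum_div, Finset.sum_neg_distrib]
  rw [e]
  exact tendsto_finsetProd _ fun i _ ↦ tendsto_cos_pow _

/-- The standard Gaussian measure on `ℝⁿ`, given by its density. -/
noncomputable def gaussianDensityMeasure (n : ℕ) : Measure (EuclideanSpace ℝ (Fin n)) :=
  volume.withDensity
    (fun x => ENNReal.ofReal ((2 * π) ^ (-(n : ℝ) / 2) * Real.exp (-‖x‖ ^ 2 / 2)))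

lemma charFun_gaussianDensityMeasure {n : ℕ} (t : EuclideanSpace ℝ (Fin n)) :
    charFun (gaussianDensityMeasure n) t = (exp (-‖t‖ ^ 2 / 2) : ℝ) := by
  rw [charFun_apply, gaussianDensityMeasure,
    integral_withDensity_eq_integral_toReal_smul (by fun_prop) (by simp)]
  have h (x : EuclideanSpace ℝ (Fin n)) :
      (ENNReal.ofReal ((2 * π) ^ (-(n : ℝ) / 2) * Real.exp (-‖x‖ ^ 2 / 2))).toReal •
        Complex.exp (inner ℝ x t * Complex.I) =
      (((2 * π) ^ (-(n : ℝ) / 2) : ℝ) : ℂ) *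
        Complex.exp (-(1 / 2 : ℂ) * ‖x‖ ^ 2 + Complex.I * (inner ℝ t x : ℝ)) := by
    rw [ENNReal.toReal_ofReal (by positivity), Complex.real_smul, Complex.ofReal_mul,
      Complex.ofReal_exp, mul_assoc, ← Complex.exp_add, real_inner_comm]
    congr 2
    push_cast
    ring
  simp_rw [h]
  rw [integral_const_mul, GaussianFourier.integral_cexp_neg_mul_sq_norm_add (by norm_num)]
  have e : ((π : ℂ) / (1 / 2)) ^ (Module.finrank ℝ (EuclideanSpace ℝ (Fin n)) / 2 : ℂ) =
      (((2 * π) ^ ((n : ℝ) / 2) : ℝ) : ℂ) := by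
    rw [Complex.ofReal_cpow (by positivity)]
    simp
    ring_nf
  rw [e, ← mul_assoc, ← Complex.ofReal_mul, ← rpow_add (by positivity)]
  push_cast
  rw [Complex.I_sq]
  ring_nf
  simp

instance (n : ℕ) : IsProbabilityMeasure (gaussianDensityMeasure n) where
  measure_univ := by
    have h := charFun_gaussianDensityMeasure (0 : EuclideanSpace ℝ (Fin n))
    rw [charFun_zero] at h
    have h2 : (gaussianDensityMeasure n).real Set.univ = 1 := by
      simpa using h
    rwa [measureReal_def, ENNReal.toReal_eq_one_iff] at h2

lemma tendsto_integral_scaledBasis {n : ℕ} {F : EuclideanSpace ℝ (Fin n) → ℝ} {C : ℝ}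
    (hF : Continuous F) (hC : ∀ x, ‖F x‖ ≤ C) :
    Tendsto (fun m ↦ cubeAvg fun ω ↦ F (signedSum (scaledBasis n m) ω)) atTop
      (𝓝 (∫ x, F x ∂gaussianDensityMeasure n)) := by
  let μ (m : ℕ) : ProbabilityMeasure (EuclideanSpace ℝ (Fin n)) :=
    ⟨signedSumLaw (scaledBasis n m), inferInstance⟩
  let μ₀ : ProbabilityMeasure (EuclideanSpace ℝ (Fin n)) :=
    ⟨gaussianDensityMeasure n, inferInstance⟩
  have h : Tendsto μ atTop (𝓝 μ₀) := ProbabilityMeasure.tendsto_of_tendsto_charFun fun t ↦ by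
    change Tendsto (fun m ↦ charFun (signedSumLaw (scaledBasis n m)) t) atTop
      (𝓝 (charFun (gaussianDensityMeasure n) t))
    rw [charFun_gaussianDensityMeasure]
    exact tendsto_charFun_scaledBasis t
  have h2 := ProbabilityMeasure.tendsto_iff_forall_integral_tendsto.1 h
    (BoundedContinuousFunction.ofNormedAddCommGroup F hF C hC)
  refine h2.congr fun m ↦ ?_
  change ∫ x, F x ∂signedSumLaw (scaledBasis n m) = _
  rw [integral_signedSumLaw, cubeAvg, smul_eq_mul, div_eq_inv_mul]

lemma abs_sub_sub_fderiv_le {E : Type*} [NormedAddCommGroup E] [NormedSpace ℝ E] {g : E → ℝ}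
    (hg : Differentiable ℝ g) {K : ℝ}
    (hK : ∀ x y, ‖fderiv ℝ g x - fderiv ℝ g y‖ ≤ K * ‖x - y‖) (hK0 : 0 ≤ K) (x w : E) :
    |g x - g (x - w) - fderiv ℝ g x w| ≤ K * ‖w‖ ^ 2 := by
  have h := (convex_closedBall x ‖w‖).norm_image_sub_le_of_norm_fderiv_le' (𝕜 := ℝ) (f := g)
    (φ := fderiv ℝ g x) (C := K * ‖w‖) (x := x - w) (y := x) (fun y _ ↦ hg y)
    (fun y hy ↦ (hK y x).trans (by gcongr; simpa [dist_eq_norm] using hy))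
    (by simp) (by simp)
  rw [sub_sub_cancel, norm_eq_abs] at h
  linarith

lemma cubeDiff_signedSum_sq_le {N : ℕ} {E : Type*} [NormedAddCommGroup E] [NormedSpace ℝ E]
    {g : E → ℝ} (hg : Differentiable ℝ g) {K C : ℝ}
    (hK : ∀ x y, ‖fderiv ℝ g x - fderiv ℝ g y‖ ≤ K * ‖x - y‖) (hK0 : 0 ≤ K)
    (hC : ∀ x, ‖fderiv ℝ g x‖ ≤ C) (v : Fin N → E) (j : Fin N) (ω : Fin N → Bool) :
    cubeDiff (fun ω ↦ g (signedSum v ω)) j ω ^ 2 ≤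
      fderiv ℝ g (signedSum v ω) (v j) ^ 2 + (4 * K * C * ‖v j‖ ^ 3 + 4 * K ^ 2 * ‖v j‖ ^ 4) := by
  set x := signedSum v ω
  obtain ⟨w, hw, hws⟩ : ∃ w, w = (if ω j then v j else -v j) ∧ (w = v j ∨ w = -v j) :=
    ⟨_, rfl, by split_ifs <;> simp⟩
  have hn : ‖w‖ = ‖v j‖ := by rcases hws with h | h <;> simp [h]
  have hsq : fderiv ℝ g x (v j) ^ 2 = fderiv ℝ g x w ^ 2 := by
    rcases hws with h | h <;> simp [h]
  have hd : cubeDiff (fun ω ↦ g (signedSum v ω)) j ω = (g x - g (x - (2 : ℝ) • w)) / 2 := by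
    simp only [cubeDiff, signedSum_update, ← hw]
    rw [two_smul, two_smul]
  have h1 := abs_sub_sub_fderiv_le hg hK hK0 x ((2 : ℝ) • w)
  rw [map_smul, norm_smul, smul_eq_mul, norm_two, hn] at h1
  have h2 : |fderiv ℝ g x w| ≤ C * ‖v j‖ := by
    rw [← hn]
    exact (fderiv ℝ g x).le_of_opNorm_le (hC x) w
  rw [hd, hsq]
  set a := fderiv ℝ g x w
  set b := (g x - g (x - (2 : ℝ) • w)) / 2 with hb
  set r := ‖v j‖
  have h3 : |b - a| ≤ 2 * K * r ^ 2 := by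
    rw [show g x - g (x - (2 : ℝ) • w) - 2 * a = 2 * (b - a) by rw [hb]; ring, abs_mul,
      abs_two] at h1
    linarith
  have h4 : |a| * |b - a| ≤ (C * r) * (2 * K * r ^ 2) := by gcongr; exact (abs_nonneg _).trans h2
  have h5 : |b - a| ^ 2 ≤ (2 * K * r ^ 2) ^ 2 := by gcongr
  have h6 : a * (b - a) ≤ |a| * |b - a| := by rw [← abs_mul]; exact le_abs_self _
  rw [sq_abs] at h5
  nlinarith

lemma sum_cubeDiff_scaledBasis_sq_le {n m : ℕ} (hm : 0 < m) {g : EuclideanSpace ℝ (Fin n) → ℝ}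
    (hg : Differentiable ℝ g) {K C : ℝ}
    (hK : ∀ x y, ‖fderiv ℝ g x - fderiv ℝ g y‖ ≤ K * ‖x - y‖) (hK0 : 0 ≤ K)
    (hC : ∀ x, ‖fderiv ℝ g x‖ ≤ C) (ω : Fin (m * n) → Bool) :
    ∑ j, cubeDiff (fun ω ↦ g (signedSum (scaledBasis n m) ω)) j ω ^ 2 ≤
      ‖fderiv ℝ g (signedSum (scaledBasis n m) ω)‖ ^ 2 +
        n * (4 * K * C * (√m)⁻¹ + 4 * K ^ 2 * (√m)⁻¹ ^ 2) := by
  have hm0 : (0 : ℝ) < m := by exact_mod_cast hm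
  have hmm : (m : ℝ) * (√m)⁻¹ ^ 2 = 1 := by
    rw [inv_pow, sq_sqrt hm0.le, mul_inv_cancel₀ hm0.ne']
  refine (Finset.sum_le_sum fun j _ ↦ cubeDiff_signedSum_sq_le hg hK hK0 hC _ j ω).trans ?_
  have hn (j : Fin (m * n)) : ‖scaledBasis n m j‖ = (√m)⁻¹ := by
    simp [scaledBasis, norm_smul]
  set φ := fderiv ℝ g (signedSum (scaledBasis n m) ω)
  have hφ : ∑ j, φ (scaledBasis n m j) ^ 2 = ‖φ‖ ^ 2 := by
    rw [← finProdFinEquiv.sum_comp, Fintype.sum_prod_type_right,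
      ← (InnerProductSpace.toDual ℝ _).symm.norm_map φ,
      ← (EuclideanSpace.basisFun (Fin n) ℝ).sum_sq_norm_inner_left]
    refine Finset.sum_congr rfl fun i _ ↦ ?_
    simp only [scaledBasis, Equiv.symm_apply_apply, map_smul, smul_eq_mul,
      InnerProductSpace.toDual_symm_apply, norm_eq_abs, sq_abs, Finset.sum_const,
      Finset.card_univ, Fintype.card_fin, nsmul_eq_mul]
    rw [mul_pow, ← mul_assoc, hmm, one_mul]
  simp only [hn]
  rw [Finset.sum_add_distrib, hφ]
  simp only [Finset.sum_const, Finset.card_univ, Fintype.card_fin, nsmul_eq_mul]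
  push_cast
  refine le_of_eq ?_
  linear_combination (n * (4 * K * C * (√m)⁻¹ + 4 * K ^ 2 * (√m)⁻¹ ^ 2)) * hmm

lemma minorant_anti {x s s' α δ : ℝ} (hδ : 0 < δ) (hα : δ ≤ α) {R : ℝ} (hR : 0 ≤ R)
    (h : s ≤ s' + R) : minorant x s' α - 3 / 8 * (R / δ) ≤ minorant x s α := by
  have hα0 : 0 < α := hδ.trans_le hα
  have h1 : s / α ≤ s' / α + R / δ := calc
    s / α ≤ (s' + R) / α := by gcongr
    _ = s' / α + R / α := add_div _ _ _
    _ ≤ s' / α + R / δ := by gcongr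
  unfold minorant
  linarith

/-- The main inequality for functions bounded away from zero. -/
theorem integral_rpow_sub_le_of_pos {n : ℕ} {g : EuclideanSpace ℝ (Fin n) → ℝ}
    (hg : ContDiff ℝ 1 g) {ε B K C : ℝ} (hε : 0 < ε) (hgε : ∀ x, ε ≤ g x) (hB : ∀ x, g x ≤ B)
    (hK : ∀ x y, ‖fderiv ℝ g x - fderiv ℝ g y‖ ≤ K * ‖x - y‖) (hK0 : 0 ≤ K)
    (hC : ∀ x, ‖fderiv ℝ g x‖ ≤ C) :
    ∫ x, (g x ^ ((3 : ℝ) / 2) - 1 / √2 * ‖fderiv ℝ g x‖ ^ ((3 : ℝ) / 2))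
      ∂gaussianDensityMeasure n ≤ (∫ x, g x ∂gaussianDensityMeasure n) ^ ((3 : ℝ) / 2) := by
  have hg0 (x) : 0 < g x := hε.trans_le (hgε x)
  have hC0 : 0 ≤ C := (norm_nonneg _).trans (hC 0)
  have hgd : Differentiable ℝ g := hg.differentiable one_ne_zero
  have hcf : Continuous fun x ↦ fderiv ℝ g x := hg.continuous_fderiv one_ne_zero
  set J : EuclideanSpace ℝ (Fin n) → ℝ :=
    fun x ↦ g x ^ ((3 : ℝ) / 2) - 1 / √2 * ‖fderiv ℝ g x‖ ^ ((3 : ℝ) / 2)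
  have hJc : Continuous J := (hg.continuous.rpow_const fun _ ↦ Or.inr (by norm_num)).sub
    (continuous_const.mul (hcf.norm.rpow_const fun _ ↦ Or.inr (by norm_num)))
  have hJb (x) : ‖J x‖ ≤ B ^ ((3 : ℝ) / 2) + 1 / √2 * C ^ ((3 : ℝ) / 2) := by
    refine (norm_sub_le _ _).trans ?_
    have := hg0 x
    rw [norm_of_nonneg (by positivity), norm_of_nonneg (by positivity)]
    gcongr
    · exact hB x
    · exact hC x
  have hgb (x) : ‖g x‖ ≤ B := by rw [norm_of_nonneg (hg0 x).le]; exact hB x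
  let R (m : ℕ) : ℝ := n * (4 * K * C * (√m)⁻¹ + 4 * K ^ 2 * (√m)⁻¹ ^ 2)
  have hR : Tendsto (fun m ↦ 3 / 8 * (R m / √ε)) atTop (𝓝 0) := by
    have h0 : Tendsto (fun m : ℕ ↦ (√m)⁻¹) atTop (𝓝 0) :=
      tendsto_inv_atTop_zero.comp <| Real.tendsto_sqrt_atTop.comp tendsto_natCast_atTop_atTop
    have := (((h0.const_mul (4 * K * C)).add ((h0.pow 2).const_mul (4 * K ^ 2))).const_mul
      (n : ℝ)).div_const √ε |>.const_mul (3 / 8)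
    simpa [R] using this
  have lim1 := (tendsto_integral_scaledBasis hJc hJb).sub hR
  have lim2 := (tendsto_integral_scaledBasis hg.continuous hgb).rpow_const
    (p := (3 : ℝ) / 2) (Or.inr (by norm_num))
  rw [sub_zero] at lim1
  refine le_of_tendsto_of_tendsto lim1 lim2 ?_
  filter_upwards [eventually_gt_atTop 0] with m hm
  set X := signedSum (scaledBasis n m)
  let α (ω : Fin (m * n) → Bool) : ℝ := √(g (X ω) + ‖fderiv ℝ g (X ω)‖ / 2)
  have hα (ω) : √ε ≤ α ω := by
    apply sqrt_le_sqrt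
    have := norm_nonneg (fderiv ℝ g (X ω))
    linarith [hgε (X ω)]
  have hα0 (ω) : 0 < α ω := (sqrt_pos.2 hε).trans_le (hα ω)
  have hR0 : 0 ≤ R m := by positivity
  have main := cubeAvg_minorant_le (fun ω ↦ g (X ω)) α hα0
  have avg_nonneg {F : (Fin (m * n) → Bool) → ℝ} (hF : ∀ ω, 0 ≤ F ω) : 0 ≤ cubeAvg F :=
    div_nonneg (Finset.sum_nonneg fun ω _ ↦ hF ω) (by positivity)
  have lower : cubeAvg (fun ω ↦ J (X ω)) - 3 / 8 * (R m / √ε) ≤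
      cubeAvg fun ω ↦ minorant (g (X ω)) (∑ i, cubeDiff (fun ω ↦ g (X ω)) i ω ^ 2) (α ω) := by
    have e : cubeAvg (fun ω ↦ J (X ω)) - 3 / 8 * (R m / √ε) =
        cubeAvg fun ω ↦ J (X ω) - 3 / 8 * (R m / √ε) := by
      simp [cubeAvg, Finset.sum_sub_distrib, sub_div]
    rw [e]
    refine cubeAvg_mono fun ω ↦ ?_
    refine le_trans ?_ (minorant_anti (sqrt_pos.2 hε) (hα ω) hR0
      (sum_cubeDiff_scaledBasis_sq_le hm hgd hK hK0 hC ω))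
    gcongr
    exact le_minorant_sqrt (hg0 _) (norm_nonneg _)
  exact lower.trans (main.trans (minorant_zero_le (avg_nonneg fun ω ↦ (hg0 _).le)
    (avg_nonneg fun ω ↦ (hα0 ω).le)))

/-- for the standard Gaussian measure `γ` on `ℝⁿ` and smooth bounded
nonnegative `f` with bounded derivatives,
`∫ f^{3/2} dγ − (∫ f dγ)^{3/2} ≤ (1/√2) ∫ ‖∇f‖^{3/2} dγ`. -/
theorem stmt_15 (n : ℕ) (γ : Measure (EuclideanSpace ℝ (Fin n)))
    (hγ : γ = volume.withDensity
      (fun x => ENNReal.ofReal ((2 * π) ^ (-(n : ℝ) / 2) * Real.exp (-‖x‖ ^ 2 / 2))))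
    (f : EuclideanSpace ℝ (Fin n) → ℝ)
    (hf : ContDiff ℝ (⊤ : ℕ∞) f)
    (hpos : ∀ x, 0 ≤ f x)
    (hfd : ∀ i : ℕ, ∃ C : ℝ, ∀ x, ‖iteratedFDeriv ℝ i f x‖ ≤ C) :
    ∫ x, (f x) ^ ((3 : ℝ) / 2) ∂γ - (∫ x, f x ∂γ) ^ ((3 : ℝ) / 2)
      ≤ (1 / Real.sqrt 2) * ∫ x, ‖fderiv ℝ f x‖ ^ ((3 : ℝ) / 2) ∂γ := by
  obtain rfl : γ = gaussianDensityMeasure n := hγ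
  obtain ⟨B, hB⟩ := hfd 0
  obtain ⟨C, hC⟩ := hfd 1
  obtain ⟨K, hK⟩ := hfd 2
  simp only [norm_iteratedFDeriv_zero] at hB
  simp only [norm_iteratedFDeriv_one] at hC
  have hK0 : 0 ≤ K := (norm_nonneg _).trans (hK 0)
  have hf1 : ContDiff ℝ 1 f := hf.of_le (by exact_mod_cast le_top)
  have hf2 : ContDiff ℝ 1 (fderiv ℝ f) :=
    hf.fderiv_right (m := 1) (by norm_cast)
  have hLip (x y) : ‖fderiv ℝ f x - fderiv ℝ f y‖ ≤ K * ‖x - y‖ :=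
    convex_univ.norm_image_sub_le_of_norm_fderiv_le (𝕜 := ℝ)
      (fun z _ ↦ hf2.differentiable one_ne_zero z)
      (fun z _ ↦ by
        rw [← norm_iteratedFDeriv_one, norm_iteratedFDeriv_fderiv]
        exact hK z) (Set.mem_univ y) (Set.mem_univ x)
  have hcf : Continuous fun x ↦ fderiv ℝ f x := hf1.continuous_fderiv one_ne_zero
  have hB' (x) : f x ≤ B := (le_abs_self _).trans (hB x)
  have integrable_of_bound {F : EuclideanSpace ℝ (Fin n) → ℝ} (hF : Continuous F) (D : ℝ)
      (hD : ∀ x, 0 ≤ F x ∧ F x ≤ D) : Integrable F (gaussianDensityMeasure n) :=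
    .of_bound hF.aestronglyMeasurable D (.of_forall fun x ↦ by
      rw [norm_of_nonneg (hD x).1]; exact (hD x).2)
  have int_f := integrable_of_bound hf.continuous B fun x ↦ ⟨hpos x, hB' x⟩
  have int_df := integrable_of_bound
    (hcf.norm.rpow_const (p := (3 : ℝ) / 2) fun _ ↦ Or.inr (by norm_num)) (C ^ ((3 : ℝ) / 2))
    fun x ↦ ⟨by positivity, by gcongr; exact hC x⟩
  have key {ε : ℝ} (hε : 0 < ε) : ∫ x, f x ^ ((3 : ℝ) / 2) ∂gaussianDensityMeasure n -
      (1 / √2) * ∫ x, ‖fderiv ℝ f x‖ ^ ((3 : ℝ) / 2) ∂gaussianDensityMeasure n ≤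
      (∫ x, f x ∂gaussianDensityMeasure n + ε) ^ ((3 : ℝ) / 2) := by
    have int_rpow {δ : ℝ} (hδ : 0 ≤ δ) :
        Integrable (fun x ↦ (f x + δ) ^ ((3 : ℝ) / 2)) (gaussianDensityMeasure n) :=
      integrable_of_bound ((hf.continuous.add continuous_const).rpow_const (p := (3 : ℝ) / 2)
        fun _ ↦ Or.inr (by norm_num)) ((B + δ) ^ ((3 : ℝ) / 2)) fun x ↦ by
          have := add_nonneg (hpos x) hδ
          exact ⟨by positivity, by gcongr; exact hB' x⟩
    have h := integral_rpow_sub_le_of_pos (g := fun x ↦ f x + ε) (B := B + ε) (C := C) (K := K)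
      (hf1.add contDiff_const) hε (fun x ↦ by linarith [hpos x]) (fun x ↦ by linarith [hB' x])
      (by simpa only [fderiv_add_const] using hLip) hK0
      (by simpa only [fderiv_add_const] using hC)
    simp only [fderiv_add_const] at h
    rw [integral_sub (int_rpow hε.le) (int_df.const_mul _), integral_const_mul,
      integral_add int_f (integrable_const _)] at h
    simp only [integral_const, probReal_univ, one_smul] at h
    refine le_trans ?_ h
    refine sub_le_sub_right (integral_mono (by simpa using int_rpow le_rfl) (int_rpow hε.le)
      fun x ↦ ?_) _
    have := hpos x
    dsimp only
    gcongr
    linarith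
  have lim : Tendsto (fun ε : ℝ ↦ (∫ x, f x ∂gaussianDensityMeasure n + ε) ^ ((3 : ℝ) / 2))
      (𝓝[>] 0) (𝓝 ((∫ x, f x ∂gaussianDensityMeasure n) ^ ((3 : ℝ) / 2))) := by
    have hc : Continuous fun ε : ℝ ↦
        (∫ x, f x ∂gaussianDensityMeasure n + ε) ^ ((3 : ℝ) / 2) :=
      (continuous_const.add continuous_id).rpow_const fun _ ↦ Or.inr (by norm_num)
    simpa using (hc.tendsto 0).mono_left nhdsWithin_le_nhds
  have := ge_of_tendsto lim (by filter_upwards [self_mem_nhdsWithin] with ε hε using key hε)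
  linarith
end

section
/- Let γ be the standard Gaussian measure on ℝ and let m be an odd positive integer. Then for every smooth compactly supported function f : ℝ → ℝ, ∫_ℝ Σ_{k=0}^{m} ((−1)^k / k!) · (f^{(k)}(x))² dγ(x) ≤ (∫_ℝ f dγ)². Equivalently, Σ_{k=1}^{m} ((−1)^{k+1}/k!) ∫_ℝ (f^{(k)})² dγ ≤ ∫_ℝ f² dγ − (∫_ℝ f dγ)² (the Houdré–Kagan lower bound in dimension one). -/
open MeasureTheory Real ProbabilityTheory

lemma integrable_id_stdGaussian : Integrable (fun x : ℝ => x) (gaussianReal 0 1) :=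
  (memLp_id_gaussianReal 1).integrable (by simp)

lemma Continuous.integrable_of_abs_le {μ : Measure ℝ} [IsFiniteMeasure μ] {h : ℝ → ℝ} {C : ℝ}
    (hc : Continuous h) (hC : ∀ x, |h x| ≤ C) : Integrable h μ :=
  Integrable.of_bound hc.aestronglyMeasurable C (ae_of_all _ hC)

lemma integrable_stdGaussian_iff {h : ℝ → ℝ} :
    Integrable h (gaussianReal 0 1) ↔ Integrable (fun x => h x * gaussianPDFReal 0 1 x) := by
  rw [gaussianReal_of_var_ne_zero _ one_ne_zero,
    integrable_withDensity_iff (measurable_gaussianPDF 0 1)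
      (ae_of_all _ fun _ => gaussianPDF_lt_top)]
  simp only [toReal_gaussianPDF]

lemma hasDerivAt_gaussianPDFReal_std (x : ℝ) :
    HasDerivAt (gaussianPDFReal 0 1) (-x * gaussianPDFReal 0 1 x) x := by
  have h1 : HasDerivAt (fun y : ℝ => -(y - 0) ^ 2 / (2 * ((1 : NNReal) : ℝ))) (-x) x := by
    have := (((hasDerivAt_id x).sub_const 0).pow 2).neg.div_const (2 * ((1 : NNReal) : ℝ))
    convert! this using 1
    simp
    ring
  have h2 := (h1.exp).const_mul ((√(2 * π * ((1 : NNReal) : ℝ)))⁻¹)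
  rw [gaussianPDFReal_def]
  convert! h2 using 1
  ring

/-- Gaussian integration by parts (Stein's identity). -/
lemma integral_id_mul_stdGaussian {h h' : ℝ → ℝ} {C C' : ℝ}
    (hd : ∀ x, HasDerivAt h (h' x) x) (hc : Continuous h')
    (hC : ∀ x, |h x| ≤ C) (hC' : ∀ x, |h' x| ≤ C') :
    ∫ x, x * h x ∂(gaussianReal 0 1) = ∫ x, h' x ∂(gaussianReal 0 1) := by
  have hcont : Continuous h := continuous_iff_continuousAt.2 fun x => (hd x).continuousAt
  have i0 : Integrable h (gaussianReal 0 1) := hcont.integrable_of_abs_le hC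
  have i1 : Integrable h' (gaussianReal 0 1) := hc.integrable_of_abs_le hC'
  have i2 : Integrable (fun x => x * h x) (gaussianReal 0 1) :=
    integrable_id_stdGaussian.mul_bdd (c := C) hcont.aestronglyMeasurable (ae_of_all _ hC)
  have i3 := i1.sub i2
  have key := integral_eq_zero_of_hasDerivAt_of_integrable
    (f := fun x => h x * gaussianPDFReal 0 1 x)
    (f' := fun x => (h' x - x * h x) * gaussianPDFReal 0 1 x)
    (fun x => by
      convert! (hd x).mul (hasDerivAt_gaussianPDFReal_std x) using 1
      ring)
    (integrable_stdGaussian_iff.1 i3) (integrable_stdGaussian_iff.1 i0)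
  have h3 : ∫ x, (h' x - x * h x) ∂(gaussianReal 0 1) = 0 := by
    rw [integral_gaussianReal_eq_integral_smul one_ne_zero]
    simpa only [smul_eq_mul, mul_comm] using key
  rw [integral_sub i1 i2] at h3
  linarith

/-- The Ornstein–Uhlenbeck average of `F` at correlation `ρ`, in the parametrization
`w ↦ 𝔼 F (√ρ w + √(1 - ρ) Z)`. -/
noncomputable def gaussianSmoothing (F : ℝ → ℝ) (ρ w : ℝ) : ℝ :=
  ∫ z, F (√ρ * w + √(1 - ρ) * z) ∂(gaussianReal 0 1)

/-- The correlation `𝔼 F(X) F(Y)` of two standard Gaussians with covariance `ρ`. -/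
noncomputable def gaussianCorrelation (F : ℝ → ℝ) (ρ : ℝ) : ℝ :=
  ∫ w, gaussianSmoothing F ρ w ^ 2 ∂(gaussianReal 0 1)

lemma gaussianCorrelation_nonneg (F : ℝ → ℝ) (ρ : ℝ) : 0 ≤ gaussianCorrelation F ρ :=
  integral_nonneg fun _ => sq_nonneg _

lemma gaussianCorrelation_zero (F : ℝ → ℝ) :
    gaussianCorrelation F 0 = (∫ x, F x ∂(gaussianReal 0 1)) ^ 2 := by
  simp [gaussianCorrelation, gaussianSmoothing]

lemma gaussianCorrelation_one (F : ℝ → ℝ) :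
    gaussianCorrelation F 1 = ∫ x, F x ^ 2 ∂(gaussianReal 0 1) := by
  simp [gaussianCorrelation, gaussianSmoothing]

lemma abs_gaussianSmoothing_le {F : ℝ → ℝ} {C : ℝ} (hC : ∀ x, |F x| ≤ C) (ρ w : ℝ) :
    |gaussianSmoothing F ρ w| ≤ C := by
  have := norm_integral_le_of_norm_le_const (μ := gaussianReal 0 1)
    (f := fun z => F (√ρ * w + √(1 - ρ) * z)) (C := C) (ae_of_all _ fun z => hC _)
  simpa [gaussianSmoothing] using this

lemma continuous_gaussianSmoothing {F : ℝ → ℝ} {C : ℝ} (hF : Continuous F)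
    (hC : ∀ x, |F x| ≤ C) : Continuous fun p : ℝ × ℝ => gaussianSmoothing F p.1 p.2 := by
  refine continuous_of_dominated (bound := fun _ => C) (fun p => ?_)
    (fun p => ae_of_all _ fun z => hC _) (integrable_const C) (ae_of_all _ fun z => ?_)
  · exact Continuous.aestronglyMeasurable (by fun_prop)
  · fun_prop

lemma continuous_gaussianSmoothing_right {F : ℝ → ℝ} {C : ℝ} (hF : Continuous F)
    (hC : ∀ x, |F x| ≤ C) (ρ : ℝ) : Continuous (gaussianSmoothing F ρ) :=
  (continuous_gaussianSmoothing hF hC).comp (by fun_prop : Continuous fun w : ℝ => (ρ, w))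

lemma continuous_gaussianCorrelation {F : ℝ → ℝ} {C : ℝ} (hF : Continuous F)
    (hC : ∀ x, |F x| ≤ C) : Continuous (gaussianCorrelation F) := by
  refine continuous_of_dominated (bound := fun _ => C ^ 2) (fun ρ => ?_)
    (fun ρ => ae_of_all _ fun w => ?_) (integrable_const _) (ae_of_all _ fun w => ?_)
  · exact ((continuous_gaussianSmoothing_right hF hC ρ).pow 2).aestronglyMeasurable
  · rw [norm_pow]
    exact pow_le_pow_left₀ (norm_nonneg _) (abs_gaussianSmoothing_le hC ρ w) 2
  · exact ((continuous_gaussianSmoothing hF hC).comp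
      (by fun_prop : Continuous fun ρ : ℝ => (ρ, w))).pow 2

lemma hasDerivAt_gaussianSmoothing_right {F F' : ℝ → ℝ} {C C' : ℝ}
    (hd : ∀ x, HasDerivAt F (F' x) x) (hc : Continuous F')
    (hC : ∀ x, |F x| ≤ C) (hC' : ∀ x, |F' x| ≤ C') (ρ w : ℝ) :
    HasDerivAt (gaussianSmoothing F ρ) (√ρ * gaussianSmoothing F' ρ w) w := by
  have hF : Continuous F := continuous_iff_continuousAt.2 fun x => (hd x).continuousAt
  have := (hasDerivAt_integral_of_dominated_loc_of_deriv_le (μ := gaussianReal 0 1) (x₀ := w)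
    (F := fun w z => F (√ρ * w + √(1 - ρ) * z))
    (F' := fun w z => √ρ * F' (√ρ * w + √(1 - ρ) * z)) (bound := fun _ => √ρ * C')
    (s := Set.univ) Filter.univ_mem
    (Filter.Eventually.of_forall fun w => Continuous.aestronglyMeasurable (by fun_prop))
    (Continuous.integrable_of_abs_le (by fun_prop) fun z => hC _)
    (Continuous.aestronglyMeasurable (by fun_prop))
    (ae_of_all _ fun z w _ => by
      rw [norm_mul, Real.norm_of_nonneg (Real.sqrt_nonneg ρ)]
      exact mul_le_mul_of_nonneg_left (hC' _) (Real.sqrt_nonneg ρ))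
    (integrable_const _)
    (ae_of_all _ fun z w _ => by
      have h1 : HasDerivAt (fun w => √ρ * w + √(1 - ρ) * z) (√ρ) w := by
        simpa using ((hasDerivAt_id w).const_mul (√ρ)).add_const (√(1 - ρ) * z)
      convert! (hd _).comp w h1 using 1
      ring)).2
  rwa [integral_const_mul] at this

lemma exists_nhds_inv_sqrt_le {ρ : ℝ} (hρ : ρ ∈ Set.Ioo (0 : ℝ) 1) :
    ∃ s ∈ nhds ρ, ∃ K, s ⊆ Set.Ioo 0 1 ∧
      ∀ r ∈ s, |1 / (2 * √r)| ≤ K ∧ |1 / (2 * √(1 - r))| ≤ K := by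
  obtain ⟨h0, h1⟩ := hρ
  refine ⟨Set.Ioo (ρ / 2) ((1 + ρ) / 2), Ioo_mem_nhds (by linarith) (by linarith),
    max (1 / (2 * √(ρ / 2))) (1 / (2 * √((1 - ρ) / 2))), ?_, ?_⟩
  · exact Set.Ioo_subset_Ioo (by linarith) (by linarith)
  · rintro r ⟨hr0, hr1⟩
    have p0 : 0 < √(ρ / 2) := Real.sqrt_pos.2 (by linarith)
    have p1 : 0 < √((1 - ρ) / 2) := Real.sqrt_pos.2 (by linarith)
    rw [abs_of_nonneg (by positivity), abs_of_nonneg (by positivity)]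
    refine ⟨le_max_of_le_left ?_, le_max_of_le_right ?_⟩
    · gcongr
    · gcongr
      linarith

lemma hasDerivAt_gaussianSmoothing_left {F F' F'' : ℝ → ℝ} {C C' C'' : ℝ}
    (hd : ∀ x, HasDerivAt F (F' x) x) (hd' : ∀ x, HasDerivAt F' (F'' x) x)
    (hc : Continuous F'') (hC : ∀ x, |F x| ≤ C) (hC' : ∀ x, |F' x| ≤ C')
    (hC'' : ∀ x, |F'' x| ≤ C'') {ρ : ℝ} (hρ : ρ ∈ Set.Ioo (0 : ℝ) 1) (w : ℝ) :
    HasDerivAt (fun r => gaussianSmoothing F r w)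
      (1 / (2 * √ρ) * w * gaussianSmoothing F' ρ w - gaussianSmoothing F'' ρ w / 2) ρ := by
  have hF : Continuous F := continuous_iff_continuousAt.2 fun x => (hd x).continuousAt
  have hF' : Continuous F' := continuous_iff_continuousAt.2 fun x => (hd' x).continuousAt
  obtain ⟨s, hs, K, hsub, hK⟩ := exists_nhds_inv_sqrt_le hρ
  have main := (hasDerivAt_integral_of_dominated_loc_of_deriv_le (μ := gaussianReal 0 1)
    (x₀ := ρ) (F := fun r z => F (√r * w + √(1 - r) * z))
    (F' := fun r z => F' (√r * w + √(1 - r) * z) *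
      (1 / (2 * √r) * w - 1 / (2 * √(1 - r)) * z))
    (bound := fun z => C' * (K * |w| + K * |z|)) hs
    (Filter.Eventually.of_forall fun w => Continuous.aestronglyMeasurable (by fun_prop))
    (Continuous.integrable_of_abs_le (by fun_prop) fun z => hC _)
    (Continuous.aestronglyMeasurable (by fun_prop))
    (ae_of_all _ fun z r hr => by
      have hC0 : 0 ≤ C' := (abs_nonneg _).trans (hC' 0)
      rw [norm_mul]
      refine mul_le_mul (hC' _) ?_ (norm_nonneg _) hC0
      refine (norm_sub_le _ _).trans ?_
      rw [norm_mul, norm_mul]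
      exact add_le_add (mul_le_mul_of_nonneg_right (hK r hr).1 (abs_nonneg _))
        (mul_le_mul_of_nonneg_right (hK r hr).2 (abs_nonneg _)))
    (((integrable_const _).add (integrable_id_stdGaussian.abs.const_mul K)).const_mul C')
    (ae_of_all _ fun z r hr => by
      have hr' := hsub hr
      have h1 : HasDerivAt (fun r => √r * w + √(1 - r) * z)
          (1 / (2 * √r) * w - 1 / (2 * √(1 - r)) * z) r := by
        have e1 := ((hasDerivAt_id r).sqrt hr'.1.ne').mul_const w
        have e2 := (((hasDerivAt_id r).const_sub 1).sqrt
          (sub_pos.2 hr'.2).ne').mul_const z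
        convert! e1.add e2 using 1
        simp only [id]
        ring
      exact (hd _).comp r h1)).2
  have hb : √(1 - ρ) ≠ 0 := (Real.sqrt_pos.2 (sub_pos.2 hρ.2)).ne'
  have stein := integral_id_mul_stdGaussian (C := C') (C' := √(1 - ρ) * C'')
    (h := fun z => F' (√ρ * w + √(1 - ρ) * z))
    (h' := fun z => √(1 - ρ) * F'' (√ρ * w + √(1 - ρ) * z))
    (fun z => by
      have h1 : HasDerivAt (fun z => √ρ * w + √(1 - ρ) * z) (√(1 - ρ)) z := by
        simpa using ((hasDerivAt_id z).const_mul (√(1 - ρ))).const_add (√ρ * w)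
      convert! (hd' _).comp z h1 using 1
      ring)
    (by fun_prop) (fun z => hC' _)
    (fun z => by
      rw [abs_mul, abs_of_nonneg (Real.sqrt_nonneg _)]
      exact mul_le_mul_of_nonneg_left (hC'' _) (Real.sqrt_nonneg _))
  rw [integral_const_mul] at stein
  have i1 : Integrable (fun z => F' (√ρ * w + √(1 - ρ) * z)) (gaussianReal 0 1) :=
    Continuous.integrable_of_abs_le (by fun_prop) fun z => hC' _
  have i2 : Integrable (fun z => z * F' (√ρ * w + √(1 - ρ) * z)) (gaussianReal 0 1) :=
    integrable_id_stdGaussian.mul_bdd (c := C') i1.aestronglyMeasurable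
      (ae_of_all _ fun z => hC' _)
  convert! main using 1
  have split : ∀ z, F' (√ρ * w + √(1 - ρ) * z) *
      (1 / (2 * √ρ) * w - 1 / (2 * √(1 - ρ)) * z) =
      1 / (2 * √ρ) * w * F' (√ρ * w + √(1 - ρ) * z) -
      1 / (2 * √(1 - ρ)) * (z * F' (√ρ * w + √(1 - ρ) * z)) := fun z => by ring
  simp_rw [split]
  rw [integral_sub (i1.const_mul _) (i2.const_mul _), integral_const_mul, integral_const_mul,
    stein, gaussianSmoothing, gaussianSmoothing]
  congr 1
  field_simp

lemma hasDerivAt_gaussianCorrelation {F F' F'' : ℝ → ℝ} {C C' C'' : ℝ}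
    (hd : ∀ x, HasDerivAt F (F' x) x) (hd' : ∀ x, HasDerivAt F' (F'' x) x)
    (hc : Continuous F'') (hC : ∀ x, |F x| ≤ C) (hC' : ∀ x, |F' x| ≤ C')
    (hC'' : ∀ x, |F'' x| ≤ C'') {ρ : ℝ} (hρ : ρ ∈ Set.Ioo (0 : ℝ) 1) :
    HasDerivAt (gaussianCorrelation F) (gaussianCorrelation F' ρ) ρ := by
  have hF : Continuous F := continuous_iff_continuousAt.2 fun x => (hd x).continuousAt
  have hF' : Continuous F' := continuous_iff_continuousAt.2 fun x => (hd' x).continuousAt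
  have cu := fun r => continuous_gaussianSmoothing_right hF hC r
  have cu' := fun r => continuous_gaussianSmoothing_right hF' hC' r
  have cu'' := fun r => continuous_gaussianSmoothing_right hc hC'' r
  have bu := fun r w => abs_gaussianSmoothing_le hC r w
  have bu' := fun r w => abs_gaussianSmoothing_le hC' r w
  have bu'' := fun r w => abs_gaussianSmoothing_le hC'' r w
  have hC0 : 0 ≤ C := (abs_nonneg _).trans (hC 0)
  have hC0' : 0 ≤ C' := (abs_nonneg _).trans (hC' 0)
  obtain ⟨s, hs, K, hsub, hK⟩ := exists_nhds_inv_sqrt_le hρ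
  have hK0 : 0 ≤ K := (abs_nonneg _).trans (hK ρ (mem_of_mem_nhds hs)).1
  have main := (hasDerivAt_integral_of_dominated_loc_of_deriv_le (μ := gaussianReal 0 1)
    (x₀ := ρ) (F := fun r w => gaussianSmoothing F r w ^ 2)
    (F' := fun r w => 2 * gaussianSmoothing F r w *
      (1 / (2 * √r) * w * gaussianSmoothing F' r w - gaussianSmoothing F'' r w / 2))
    (bound := fun w => 2 * C * (K * |w| * C' + C'' / 2)) hs
    (Filter.Eventually.of_forall fun r => ((cu r).pow 2).aestronglyMeasurable)
    (Continuous.integrable_of_abs_le (C := C ^ 2) ((cu ρ).pow 2) fun w => by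
      rw [abs_pow]
      exact pow_le_pow_left₀ (abs_nonneg _) (bu ρ w) 2)
    (Continuous.aestronglyMeasurable (by
      have := cu ρ
      have := cu' ρ
      have := cu'' ρ
      fun_prop))
    (ae_of_all _ fun w r hr => by
      rw [norm_mul, norm_mul, Real.norm_ofNat]
      refine mul_le_mul (mul_le_mul_of_nonneg_left (bu r w) zero_le_two) ?_ (norm_nonneg _)
        (by positivity)
      refine (norm_sub_le _ _).trans (add_le_add ?_ ?_)
      · rw [norm_mul, norm_mul]
        exact mul_le_mul (mul_le_mul_of_nonneg_right (hK r hr).1 (abs_nonneg _)) (bu' r w)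
          (norm_nonneg _) (by positivity)
      · rw [norm_div, Real.norm_ofNat]
        exact div_le_div_of_nonneg_right (bu'' r w) zero_le_two)
    ((((integrable_id_stdGaussian.abs.const_mul K).mul_const C').add
      (integrable_const _)).const_mul _)
    (ae_of_all _ fun w r hr => by
      convert! (hasDerivAt_gaussianSmoothing_left hd hd' hc hC hC' hC'' (hsub hr) w).pow 2
        using 1
      norm_num)).2
  have ha : √ρ ≠ 0 := (Real.sqrt_pos.2 hρ.1).ne'
  have i1 : Integrable (fun w => gaussianSmoothing F' ρ w ^ 2) (gaussianReal 0 1) :=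
    Continuous.integrable_of_abs_le (C := C' ^ 2) ((cu' ρ).pow 2) fun w => by
      rw [abs_pow]
      exact pow_le_pow_left₀ (abs_nonneg _) (bu' ρ w) 2
  have i2 : Integrable (fun w => gaussianSmoothing F ρ w * gaussianSmoothing F'' ρ w)
      (gaussianReal 0 1) :=
    Continuous.integrable_of_abs_le (C := C * C'') ((cu ρ).mul (cu'' ρ)) fun w => by
      rw [abs_mul]
      exact mul_le_mul (bu ρ w) (bu'' ρ w) (abs_nonneg _) hC0
  have i3 : Integrable (fun w => w * (gaussianSmoothing F ρ w * gaussianSmoothing F' ρ w))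
      (gaussianReal 0 1) :=
    integrable_id_stdGaussian.mul_bdd (c := C * C') ((cu ρ).mul (cu' ρ)).aestronglyMeasurable
      (ae_of_all _ fun w => by
        rw [norm_mul]
        exact mul_le_mul (bu ρ w) (bu' ρ w) (abs_nonneg _) hC0)
  have stein := integral_id_mul_stdGaussian (C := C * C') (C' := √ρ * (C' ^ 2 + C * C''))
    (h := fun w => gaussianSmoothing F ρ w * gaussianSmoothing F' ρ w)
    (h' := fun w => √ρ * (gaussianSmoothing F' ρ w ^ 2 +
      gaussianSmoothing F ρ w * gaussianSmoothing F'' ρ w))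
    (fun w => by
      convert! (hasDerivAt_gaussianSmoothing_right hd hF' hC hC' ρ w).mul
        (hasDerivAt_gaussianSmoothing_right hd' hc hC' hC'' ρ w) using 1
      ring)
    (((cu' ρ).pow 2 |>.add ((cu ρ).mul (cu'' ρ))).const_mul _)
    (fun w => by
      rw [abs_mul]
      exact mul_le_mul (bu ρ w) (bu' ρ w) (abs_nonneg _) hC0)
    (fun w => by
      rw [abs_mul, abs_of_nonneg (Real.sqrt_nonneg _)]
      refine mul_le_mul_of_nonneg_left ((abs_add_le _ _).trans (add_le_add ?_ ?_))
        (Real.sqrt_nonneg _)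
      · rw [abs_pow]
        exact pow_le_pow_left₀ (abs_nonneg _) (bu' ρ w) 2
      · rw [abs_mul]
        exact mul_le_mul (bu ρ w) (bu'' ρ w) (abs_nonneg _) hC0)
  rw [integral_const_mul, integral_add i1 i2] at stein
  convert! main using 1
  have split : ∀ w, 2 * gaussianSmoothing F ρ w *
      (1 / (2 * √ρ) * w * gaussianSmoothing F' ρ w - gaussianSmoothing F'' ρ w / 2) =
      1 / √ρ * (w * (gaussianSmoothing F ρ w * gaussianSmoothing F' ρ w)) -
        gaussianSmoothing F ρ w * gaussianSmoothing F'' ρ w := fun w => by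
    field_simp
  simp_rw [split]
  rw [integral_sub (i3.const_mul _) i2, integral_const_mul, stein, gaussianCorrelation]
  field_simp
  ring

lemma hasDerivAt_gaussianCorrelation_of_contDiff {F : ℝ → ℝ} (hF : ContDiff ℝ (⊤ : ℕ∞) F)
    (hs : HasCompactSupport F) {ρ : ℝ} (hρ : ρ ∈ Set.Ioo (0 : ℝ) 1) :
    HasDerivAt (gaussianCorrelation F) (gaussianCorrelation (deriv F) ρ) ρ := by
  have hF' : ContDiff ℝ (⊤ : ℕ∞) (deriv F) := (contDiff_infty_iff_deriv.1 hF).2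
  have hF'' : ContDiff ℝ (⊤ : ℕ∞) (deriv (deriv F)) := (contDiff_infty_iff_deriv.1 hF').2
  obtain ⟨C, hC⟩ := hs.exists_bound_of_continuous hF.continuous
  obtain ⟨C', hC'⟩ := hs.deriv.exists_bound_of_continuous hF'.continuous
  obtain ⟨C'', hC''⟩ := hs.deriv.deriv.exists_bound_of_continuous hF''.continuous
  exact hasDerivAt_gaussianCorrelation
    (fun x => (contDiff_infty_iff_deriv.1 hF).1.differentiableAt.hasDerivAt)
    (fun x => (contDiff_infty_iff_deriv.1 hF').1.differentiableAt.hasDerivAt)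
    hF''.continuous hC hC' hC'' hρ

/-- The correlation is absolutely monotone in `ρ`, so its Taylor remainders at `1` have
alternating signs. -/
lemma gaussianCorrelation_taylor_remainder_nonneg (n : ℕ) {F : ℝ → ℝ}
    (hF : ContDiff ℝ (⊤ : ℕ∞) F) (hs : HasCompactSupport F) {ρ : ℝ}
    (hρ : ρ ∈ Set.Icc (0 : ℝ) 1) :
    0 ≤ (-1 : ℝ) ^ n * (gaussianCorrelation F ρ - ∑ k ∈ Finset.range n,
      (ρ - 1) ^ k / k.factorial * gaussianCorrelation (iteratedDeriv k F) 1) := by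
  induction n generalizing F ρ with
  | zero => simpa using gaussianCorrelation_nonneg F ρ
  | succ n ih =>
    set D : ℝ → ℝ := fun ρ => (-1 : ℝ) ^ (n + 1) * (gaussianCorrelation F ρ -
      ∑ k ∈ Finset.range (n + 1),
        (ρ - 1) ^ k / k.factorial * gaussianCorrelation (iteratedDeriv k F) 1) with hD
    have hderiv : ∀ r ∈ Set.Ioo (0 : ℝ) 1, HasDerivAt D ((-1 : ℝ) ^ (n + 1) *
        (gaussianCorrelation (deriv F) r - ∑ k ∈ Finset.range n,
          (r - 1) ^ k / k.factorial *
            gaussianCorrelation (iteratedDeriv k (deriv F)) 1)) r := by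
      intro r hr
      refine ((hasDerivAt_gaussianCorrelation_of_contDiff hF hs hr).sub ?_).const_mul _
      simp_rw [Finset.sum_range_succ' _ n]
      simp only [pow_zero]
      refine HasDerivAt.add_const _ (HasDerivAt.fun_sum fun k _ => ?_)
      have h1 := ((((hasDerivAt_id r).sub_const 1).pow (k + 1)).div_const
        ((k + 1).factorial : ℝ)).mul_const (gaussianCorrelation (iteratedDeriv (k + 1) F) 1)
      convert! h1 using 1
      rw [iteratedDeriv_succ', Nat.factorial_succ]
      have : (k.factorial : ℝ) ≠ 0 := by positivity
      have : (k : ℝ) + 1 ≠ 0 := by positivity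
      simp only [id, Nat.cast_mul, Nat.cast_add, Nat.cast_one, Nat.add_sub_cancel]
      field_simp
    obtain ⟨C, hC⟩ := hs.exists_bound_of_continuous hF.continuous
    have hcont : Continuous D := by
      have := continuous_gaussianCorrelation hF.continuous hC
      fun_prop
    have hanti : AntitoneOn D (Set.Icc 0 1) := by
      refine antitoneOn_of_deriv_nonpos (convex_Icc 0 1) hcont.continuousOn ?_ ?_
      · rw [interior_Icc]
        exact fun r hr => (hderiv r hr).differentiableAt.differentiableWithinAt
      · rw [interior_Icc]
        intro r hr
        rw [(hderiv r hr).deriv, pow_succ]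
        have := ih (contDiff_infty_iff_deriv.1 hF).2 hs.deriv (Set.Ioo_subset_Icc_self hr)
        linarith
    have h1 : D 1 = 0 := by
      simp [hD, Finset.sum_range_succ']
    rw [← h1]
    exact hanti hρ (Set.right_mem_Icc.2 zero_le_one) hρ.2

lemma HasCompactSupport.iteratedDeriv_of_real {F : ℝ → ℝ} (hs : HasCompactSupport F) (k : ℕ) :
    HasCompactSupport (iteratedDeriv k F) := by
  induction k with
  | zero => simpa using hs
  | succ k ih =>
    rw [iteratedDeriv_succ]
    exact ih.deriv

/-- Houdré–Kagan lower bound in dimension one (odd `m`): for the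
standard Gaussian measure `γ` on `ℝ` and smooth compactly supported `f`,
`∫ Σ_{k=0}^{m} ((−1)^k/k!) (f^{(k)})² dγ ≤ (∫ f dγ)²`. -/
theorem stmt_16 (m : ℕ) (hodd : Odd m) (hpos : 0 < m)
    (f : ℝ → ℝ) (hf : ContDiff ℝ (⊤ : ℕ∞) f) (hsupp : HasCompactSupport f) :
    ∫ x, (∑ k ∈ Finset.range (m + 1),
        (-1 : ℝ) ^ k / (Nat.factorial k) * (iteratedDeriv k f x) ^ 2)
        ∂(gaussianReal 0 1)
      ≤ (∫ x, f x ∂(gaussianReal 0 1)) ^ 2 := by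
  have h := gaussianCorrelation_taylor_remainder_nonneg (m + 1) hf hsupp
    (Set.left_mem_Icc.2 zero_le_one)
  rw [hodd.add_one.neg_one_pow, one_mul, sub_nonneg, gaussianCorrelation_zero] at h
  rw [integral_finsetSum]
  · simpa only [zero_sub, gaussianCorrelation_one, integral_const_mul] using h
  · intro k _
    have hc : Continuous (iteratedDeriv k f) := hf.continuous_iteratedDeriv k
      (by exact_mod_cast le_top)
    obtain ⟨C, hC⟩ := (hsupp.iteratedDeriv_of_real k).exists_bound_of_continuous hc
    refine Integrable.const_mul (Continuous.integrable_of_abs_le (C := C ^ 2) (hc.pow 2)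
      fun x => ?_) _
    rw [Pi.pow_apply, abs_pow]
    exact pow_le_pow_left₀ (abs_nonneg _) (hC x) 2
end

section
/- Let μ = e^{-U(x)} dx be a probability measure on ℝⁿ with U smooth, even (U(−x) = U(x)), and Hess U(x) ≥ Id for all x. Then for every smooth bounded even function f : ℝⁿ → ℝ (f(−x) = f(x)) with bounded derivatives of all orders, ∫_{ℝⁿ} f² dμ − (∫_{ℝⁿ} f dμ)² ≤ (1/2) ∫_{ℝⁿ} ‖∇f‖² dμ (the Cordero-Erausquin–Fradelizi–Maurey inequality underlying the (B)-Theorem, in the even case). -/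
open MeasureTheory Real

section EvenPoincare

open Set Filter Topology
open scoped ContDiff Convolution

variable {n : ℕ}

local notation "E" => EuclideanSpace ℝ (Fin n)

/-- The `i`-th partial derivative. -/
noncomputable def partialDeriv (i : Fin n) (u : E → ℝ) (x : E) : ℝ :=
  fderiv ℝ u x (EuclideanSpace.single i 1)

local notation "D" => partialDeriv

/-- Smooth compactly supported functions. -/
structure IsTestFunction (u : E → ℝ) : Prop where
  contDiff : ContDiff ℝ ∞ u
  hasCompactSupport : HasCompactSupport u

@[fun_prop]
lemma ContDiff.partialDeriv {u : E → ℝ} (hu : ContDiff ℝ ∞ u) (i : Fin n) :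
    ContDiff ℝ ∞ (D i u) :=
  (hu.fderiv_right (m := ∞) (by simp)).clm_apply contDiff_const

@[fun_prop]
lemma ContDiff.continuous_partialDeriv {u : E → ℝ} (hu : ContDiff ℝ ∞ u) (i : Fin n) :
    Continuous (D i u) :=
  (hu.partialDeriv i).continuous

lemma HasCompactSupport.partialDeriv {u : E → ℝ} (hu : HasCompactSupport u) (i : Fin n) :
    HasCompactSupport (D i u) :=
  hu.fderiv_apply (𝕜 := ℝ) _

lemma IsTestFunction.partialDeriv {u : E → ℝ} (hu : IsTestFunction u) (i : Fin n) :
    IsTestFunction (D i u) :=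
  ⟨hu.1.partialDeriv i, hu.2.partialDeriv i⟩

lemma ContDiff.hasFDerivAt_infty {u : E → ℝ} (hu : ContDiff ℝ ∞ u) (x : E) :
    HasFDerivAt u (fderiv ℝ u x) x :=
  (hu.differentiable (by simp) x).hasFDerivAt

lemma partialDeriv_mul {u v : E → ℝ} (hu : ContDiff ℝ ∞ u) (hv : ContDiff ℝ ∞ v) (i : Fin n) :
    D i (fun x => u x * v x) = fun x => D i u x * v x + u x * D i v x := by
  ext x
  have := ((hu.hasFDerivAt_infty x).mul (hv.hasFDerivAt_infty x)).fderiv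
  simp only [partialDeriv]
  change fderiv ℝ (u * v) x _ = _
  rw [this]
  simp; ring

lemma partialDeriv_add {u v : E → ℝ} (hu : ContDiff ℝ ∞ u) (hv : ContDiff ℝ ∞ v) (i : Fin n) :
    D i (fun x => u x + v x) = fun x => D i u x + D i v x := by
  ext x
  have := ((hu.hasFDerivAt_infty x).add (hv.hasFDerivAt_infty x)).fderiv
  simp only [partialDeriv]
  change fderiv ℝ (u + v) x _ = _
  rw [this]
  simp

lemma partialDeriv_const_mul {u : E → ℝ} (hu : ContDiff ℝ ∞ u) (c : ℝ) (i : Fin n) :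
    D i (fun x => c * u x) = fun x => c * D i u x := by
  ext x
  have := ((hu.hasFDerivAt_infty x).const_mul c).fderiv
  simp only [partialDeriv]
  rw [this]
  simp

lemma partialDeriv_sub {u v : E → ℝ} (hu : ContDiff ℝ ∞ u) (hv : ContDiff ℝ ∞ v) (i : Fin n) :
    D i (fun x => u x - v x) = fun x => D i u x - D i v x := by
  ext x
  have := ((hu.hasFDerivAt_infty x).sub (hv.hasFDerivAt_infty x)).fderiv
  simp only [partialDeriv]
  change fderiv ℝ (u - v) x _ = _
  rw [this]
  simp

lemma partialDeriv_exp_const_mul {u : E → ℝ} (hu : ContDiff ℝ ∞ u) (c : ℝ) (i : Fin n) :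
    D i (fun x => exp (c * u x)) = fun x => c * D i u x * exp (c * u x) := by
  ext x
  have := ((hu.hasFDerivAt_infty x).const_mul c).exp.fderiv
  simp only [partialDeriv]
  rw [this]
  simp; ring

lemma partialDeriv_comp_neg {u : E → ℝ} (i : Fin n) :
    D i (fun x => u (-x)) = fun x => -D i u (-x) := by
  ext x
  simp only [partialDeriv]
  rw [show (fun x => u (-x)) = fun x => u ((-1 : ℝ) • x) by simp, fderiv_comp_smul]
  simp

lemma partialDeriv_partialDeriv {u : E → ℝ} (hu : ContDiff ℝ ∞ u) (i j : Fin n) (x : E) :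
    D i (D j u) x
      = fderiv ℝ (fderiv ℝ u) x (EuclideanSpace.single i 1) (EuclideanSpace.single j 1) := by
  have h := (hu.fderiv_right (m := ∞) (by simp)).differentiable (by simp) x
  have := (h.hasFDerivAt.clm_apply
    (hasFDerivAt_const (EuclideanSpace.single j (1 : ℝ)) x)).fderiv
  simp only [partialDeriv] at this ⊢
  change fderiv ℝ (fun y => fderiv ℝ u y (EuclideanSpace.single j 1)) x _ = _
  rw [this]
  simp

lemma partialDeriv_comm {u : E → ℝ} (hu : ContDiff ℝ ∞ u) (i j : Fin n) :
    D i (D j u) = D j (D i u) := by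
  ext x
  rw [partialDeriv_partialDeriv hu, partialDeriv_partialDeriv hu]
  exact (hu.contDiffAt.isSymmSndFDerivAt (by simpa using ENat.LEInfty.out)) _ _

lemma sum_smul_single (a : Fin n → ℝ) :
    ∑ i, a i • EuclideanSpace.single i (1 : ℝ) = WithLp.toLp 2 a := by
  ext j
  simp [Finset.sum_apply, Pi.single_apply]

lemma norm_fderiv_sq_eq_sum_partialDeriv_sq (u : E → ℝ) (x : E) :
    ‖fderiv ℝ u x‖ ^ 2 = ∑ i, D i u x ^ 2 := by
  rw [← (InnerProductSpace.toDual ℝ E).symm.norm_map, EuclideanSpace.norm_sq_eq]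
  refine Finset.sum_congr rfl fun i _ => ?_
  rw [Real.norm_eq_abs, sq_abs, partialDeriv, ← InnerProductSpace.toDual_symm_apply]
  rw [EuclideanSpace.inner_single_right]
  simp

lemma integral_partialDeriv_mul {u v : E → ℝ} (hu : ContDiff ℝ ∞ u) (hv : ContDiff ℝ ∞ v)
    (h : HasCompactSupport u ∨ HasCompactSupport v) (i : Fin n) :
    ∫ x, D i u x * v x = - ∫ x, u x * D i v x := by
  have int : ∀ {a b : E → ℝ}, Continuous a → Continuous b →
      (HasCompactSupport a ∨ HasCompactSupport b) → Integrable fun x => a x * b x := by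
    intro a b ha hb hab
    refine (ha.mul hb).integrable_of_hasCompactSupport ?_
    exact hab.elim (fun h => h.mul_right) fun h => h.mul_left
  rw [eq_comm, neg_eq_iff_eq_neg]
  refine integral_mul_fderiv_eq_neg_fderiv_mul_of_integrable ?_ ?_ ?_
    (fun x _ => hu.differentiable (by simp) x) (fun x _ => hv.differentiable (by simp) x)
  · exact int (hu.continuous_partialDeriv i) hv.continuous
      (h.imp (fun h => h.partialDeriv i) id)
  · exact int hu.continuous (hv.continuous_partialDeriv i)
      (h.imp id (fun h => h.partialDeriv i))
  · exact int hu.continuous hv.continuous h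

/-- The formal adjoint of `D i` with respect to the measure of density `exp (-U)`. -/
noncomputable def partialAdj (U : E → ℝ) (i : Fin n) (u : E → ℝ) (x : E) : ℝ :=
  D i U x * u x - D i u x

/-- The diffusion operator `Δ u - ⟨∇U, ∇u⟩`. -/
noncomputable def diffusionOp (U : E → ℝ) (u : E → ℝ) (x : E) : ℝ :=
  -∑ i, partialAdj U i (D i u) x

lemma contDiff_partialAdj {U : E → ℝ} (hU : ContDiff ℝ ∞ U) {u : E → ℝ}
    (hu : ContDiff ℝ ∞ u) (i : Fin n) :
    ContDiff ℝ ∞ (partialAdj U i u) :=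
  ((hU.partialDeriv i).mul hu).sub (hu.partialDeriv i)

lemma isTestFunction_partialAdj {U : E → ℝ} (hU : ContDiff ℝ ∞ U) {u : E → ℝ}
    (hu : IsTestFunction u) (i : Fin n) : IsTestFunction (partialAdj U i u) :=
  ⟨contDiff_partialAdj hU hu.1 i, (hu.2.mul_left).sub (hu.2.partialDeriv i)⟩

lemma contDiff_diffusionOp {U : E → ℝ} (hU : ContDiff ℝ ∞ U) {u : E → ℝ} (hu : ContDiff ℝ ∞ u) :
    ContDiff ℝ ∞ (diffusionOp U u) :=
  (ContDiff.sum fun i _ => contDiff_partialAdj hU (hu.partialDeriv i) i).neg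

lemma partialDeriv_partialAdj {U : E → ℝ} (hU : ContDiff ℝ ∞ U) {u : E → ℝ} (hu : ContDiff ℝ ∞ u)
    (i j : Fin n) (x : E) :
    D i (partialAdj U j u) x = partialAdj U j (D i u) x + D i (D j U) x * u x := by
  have h1 : partialAdj U j u = fun x => D j U x * u x - D j u x := rfl
  rw [h1, partialDeriv_sub ((hU.partialDeriv j).mul hu) (hu.partialDeriv j),
    partialDeriv_mul (hU.partialDeriv j) hu, partialDeriv_comm hu]
  simp only [partialAdj]
  ring

lemma integral_partialDeriv_mul_mul_exp_neg {U : E → ℝ} (hU : ContDiff ℝ ∞ U) {u v : E → ℝ}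
    (hu : ContDiff ℝ ∞ u) (hv : ContDiff ℝ ∞ v)
    (h : HasCompactSupport u ∨ HasCompactSupport v) (i : Fin n) :
    ∫ x, D i u x * v x * exp (-U x) = ∫ x, u x * partialAdj U i v x * exp (-U x) := by
  have hexp : ContDiff ℝ ∞ fun x => exp (-1 * U x) := (contDiff_const.mul hU).exp
  have := integral_partialDeriv_mul hu (hv.mul hexp)
    (h.imp id fun h => h.mul_right) i
  rw [partialDeriv_mul hv hexp, partialDeriv_exp_const_mul hU] at this
  simp only [neg_one_mul] at this
  simp only [mul_assoc]
  rw [this, ← integral_neg]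
  congr with x
  simp only [partialAdj]
  ring

lemma IsTestFunction.integrable {μ : Measure E} [IsFiniteMeasureOnCompacts μ] {u : E → ℝ}
    (hu : IsTestFunction u) : Integrable u μ :=
  hu.1.continuous.integrable_of_hasCompactSupport hu.2

lemma IsTestFunction.mul_left {u v : E → ℝ} (hu : ContDiff ℝ ∞ u) (hv : IsTestFunction v) :
    IsTestFunction fun x => u x * v x :=
  ⟨hu.mul hv.1, hv.2.mul_left⟩

lemma IsTestFunction.sum {ι : Type*} (s : Finset ι) {u : ι → E → ℝ}
    (hu : ∀ i ∈ s, IsTestFunction (u i)) : IsTestFunction fun x => ∑ i ∈ s, u i x := by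
  classical
  induction s using Finset.induction_on with
  | empty => simpa using ⟨contDiff_const, HasCompactSupport.zero⟩
  | insert i s hi ih =>
    simp only [Finset.sum_insert hi]
    have h1 := hu i (by simp)
    have h2 := ih fun j hj => hu j (by simp [hj])
    exact ⟨h1.1.add h2.1, h1.2.add h2.2⟩

lemma isTestFunction_diffusionOp {U : E → ℝ} (hU : ContDiff ℝ ∞ U) {u : E → ℝ}
    (hu : IsTestFunction u) : IsTestFunction (diffusionOp U u) := by
  have := IsTestFunction.sum Finset.univ fun i _ =>
    isTestFunction_partialAdj hU (hu.partialDeriv i) i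
  exact ⟨this.1.neg, this.2.neg⟩

/-- The measure of density `exp (-U)`. -/
noncomputable def gibbsMeasure (U : E → ℝ) : Measure E :=
  volume.withDensity fun x => ENNReal.ofReal (exp (-U x))

lemma integral_gibbsMeasure {U : E → ℝ} (hU : Continuous U) (F : E → ℝ) :
    ∫ x, F x ∂gibbsMeasure U = ∫ x, F x * exp (-U x) := by
  rw [gibbsMeasure, integral_withDensity_eq_integral_toReal_smul (by fun_prop) (by simp)]
  refine integral_congr_ae (ae_of_all _ fun x => ?_)
  simp [ENNReal.toReal_ofReal (exp_nonneg _), mul_comm]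

lemma integral_partialDeriv_mul_gibbsMeasure {U : E → ℝ} (hU : ContDiff ℝ ∞ U) {u v : E → ℝ}
    (hu : ContDiff ℝ ∞ u) (hv : ContDiff ℝ ∞ v)
    (h : HasCompactSupport u ∨ HasCompactSupport v) (i : Fin n) :
    ∫ x, D i u x * v x ∂gibbsMeasure U = ∫ x, u x * partialAdj U i v x ∂gibbsMeasure U := by
  rw [integral_gibbsMeasure hU.continuous, integral_gibbsMeasure hU.continuous]
  exact integral_partialDeriv_mul_mul_exp_neg hU hu hv h i

lemma integral_mul_diffusionOp {U : E → ℝ} [IsProbabilityMeasure (gibbsMeasure U)]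
    (hU : ContDiff ℝ ∞ U) {f u : E → ℝ} (hf : ContDiff ℝ ∞ f) (hu : ContDiff ℝ ∞ u)
    (h : HasCompactSupport f ∨ HasCompactSupport u) :
    ∫ x, f x * diffusionOp U u x ∂gibbsMeasure U
      = -∑ i, ∫ x, D i f x * D i u x ∂gibbsMeasure U := by
  have h1 : ∀ x, f x * diffusionOp U u x = -∑ i, f x * partialAdj U i (D i u) x := fun x => by
    rw [diffusionOp, mul_neg, Finset.mul_sum]
  simp only [h1, integral_neg]
  rw [integral_finsetSum]
  · congr 1
    refine Finset.sum_congr rfl fun i _ => ?_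
    rw [integral_partialDeriv_mul_gibbsMeasure hU hf (hu.partialDeriv i)
      (h.imp id fun h => h.partialDeriv i)]
  · refine fun i _ => IsTestFunction.integrable
      ⟨hf.mul (contDiff_partialAdj hU (hu.partialDeriv i) i), ?_⟩
    exact h.elim (fun h => h.mul_right) fun h => HasCompactSupport.mul_left
      ((h.partialDeriv i).mul_left.sub ((h.partialDeriv i).partialDeriv i))

lemma integral_diffusionOp_sq {U : E → ℝ} [IsProbabilityMeasure (gibbsMeasure U)]
    (hU : ContDiff ℝ ∞ U) {u : E → ℝ} (hu : IsTestFunction u) :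
    ∫ x, diffusionOp U u x ^ 2 ∂gibbsMeasure U
      = ∑ j, ∑ i, ∫ x, D i (D j u) x ^ 2 ∂gibbsMeasure U
        + ∫ x, ∑ j, ∑ i, D j (D i U) x * D i u x * D j u x ∂gibbsMeasure U := by
  have hL := isTestFunction_diffusionOp hU hu
  have hT : ∀ i j, IsTestFunction fun x => D j (D i U) x * D i u x * D j u x := fun i j =>
    IsTestFunction.mul_left (((hU.partialDeriv i).partialDeriv j).mul (hu.1.partialDeriv i))
      (hu.partialDeriv j)
  have hS : ∀ i j, IsTestFunction fun x => partialAdj U i (D j (D i u)) x * D j u x := fun i j =>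
    IsTestFunction.mul_left (contDiff_partialAdj hU ((hu.1.partialDeriv i).partialDeriv j) i)
      (hu.partialDeriv j)
  have hD : ∀ j x, D j (diffusionOp U u) x * D j u x
      = -∑ i, (partialAdj U i (D j (D i u)) x * D j u x
        + D j (D i U) x * D i u x * D j u x) := by
    intro j x
    have : D j (diffusionOp U u) x = -∑ i, D j (partialAdj U i (D i u)) x := by
      have hd : ∀ i, HasFDerivAt (partialAdj U i (D i u))
          (fderiv ℝ (partialAdj U i (D i u)) x) x := fun i =>
        (contDiff_partialAdj hU (hu.1.partialDeriv i) i).hasFDerivAt_infty x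
      have := (HasFDerivAt.fun_sum (u := Finset.univ) fun i _ => hd i).neg.fderiv
      simp only [partialDeriv] at this ⊢
      change fderiv ℝ (-fun x => ∑ i, partialAdj U i (D i u) x) x _ = _
      rw [this]
      simp
    rw [this, neg_mul, Finset.sum_mul]
    congr 1
    refine Finset.sum_congr rfl fun i _ => ?_
    rw [partialDeriv_partialAdj hU (hu.1.partialDeriv i)]
    ring
  simp only [pow_two]
  rw [integral_mul_diffusionOp hU hL.1 hu.1 (Or.inr hu.2), integral_finsetSum,
    ← Finset.sum_add_distrib,
    ← Finset.sum_neg_distrib]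
  · refine Finset.sum_congr rfl fun j _ => ?_
    simp only [hD, integral_neg, neg_neg]
    rw [integral_finsetSum, integral_finsetSum, ← Finset.sum_add_distrib]
    · refine Finset.sum_congr rfl fun i _ => ?_
      rw [integral_add (hS i j).integrable (hT i j).integrable]
      congr 1
      rw [partialDeriv_comm hu.1 j i]
      simp only [mul_comm (partialAdj _ _ _ _)]
      rw [← integral_partialDeriv_mul_gibbsMeasure hU (hu.1.partialDeriv j)
        ((hu.1.partialDeriv j).partialDeriv i) (Or.inl (hu.2.partialDeriv j))]
    · exact fun i _ => (hT i j).integrable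
    · exact fun i _ => (hS i j).integrable.add (hT i j).integrable
  · exact fun j _ => (IsTestFunction.sum _ fun i _ => hT i j).integrable

lemma sum_partialDeriv_sq_le_hessian {U : E → ℝ} (hU : ContDiff ℝ ∞ U)
    (hHess : ∀ x v : E, ‖v‖ ^ 2 ≤ fderiv ℝ (fderiv ℝ U) x v v) (a : Fin n → ℝ) (x : E) :
    ∑ i, a i ^ 2 ≤ ∑ j, ∑ i, D j (D i U) x * a i * a j := by
  have := hHess x (∑ i, a i • EuclideanSpace.single i (1 : ℝ))
  have hn : ‖∑ i, a i • EuclideanSpace.single i (1 : ℝ)‖ ^ 2 = ∑ i, a i ^ 2 := by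
    simp [sum_smul_single, EuclideanSpace.norm_sq_eq]
  rw [hn] at this
  simp only [map_sum, map_smul, _root_.sum_apply, _root_.smul_apply,
    smul_eq_mul, ← partialDeriv_partialDeriv hU] at this
  refine this.trans_eq ?_
  rw [Finset.sum_comm]
  refine Finset.sum_congr rfl fun j _ => ?_
  rw [Finset.mul_sum]
  refine Finset.sum_congr rfl fun i _ => ?_
  ring

lemma le_integral_diffusionOp_sq {U : E → ℝ} [IsProbabilityMeasure (gibbsMeasure U)]
    (hU : ContDiff ℝ ∞ U)
    (hHess : ∀ x v : E, ‖v‖ ^ 2 ≤ fderiv ℝ (fderiv ℝ U) x v v) {u : E → ℝ}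
    (hu : IsTestFunction u) :
    ∑ j, ∑ i, ∫ x, D i (D j u) x ^ 2 ∂gibbsMeasure U + ∑ i, ∫ x, D i u x ^ 2 ∂gibbsMeasure U
      ≤ ∫ x, diffusionOp U u x ^ 2 ∂gibbsMeasure U := by
  rw [integral_diffusionOp_sq hU hu]
  have hsq : ∀ i, IsTestFunction fun x => D i u x ^ 2 := fun i => by
    simpa only [pow_two] using (hu.partialDeriv i).mul_left (hu.1.partialDeriv i)
  gcongr
  rw [← integral_finsetSum _ fun i _ => (hsq i).integrable]
  refine integral_mono (IsTestFunction.sum _ fun i _ => hsq i).integrable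
    (IsTestFunction.sum _ fun j _ => IsTestFunction.sum _ fun i _ =>
      IsTestFunction.mul_left (((hU.partialDeriv i).partialDeriv j).mul (hu.1.partialDeriv i))
      (hu.partialDeriv j)).integrable fun x =>
    sum_partialDeriv_sq_le_hessian hU hHess (fun i => D i u x) x

/-- Convolution of real functions with respect to Lebesgue measure. -/
noncomputable def conv (ρ g : E → ℝ) : E → ℝ :=
  ρ ⋆[ContinuousLinearMap.lsmul ℝ ℝ, volume] g

lemma conv_apply (ρ g : E → ℝ) (x : E) : conv ρ g x = ∫ y, ρ (x - y) * g y :=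
  convolution_eq_swap _

lemma integrable_conv_integrand {ρ g : E → ℝ} (hρ : Continuous ρ) (hρc : HasCompactSupport ρ)
    (hg : LocallyIntegrable g) (x : E) : Integrable fun y => ρ (x - y) * g y := by
  exact hg.integrable_smul_left_of_hasCompactSupport (f := g) (g := fun y => ρ (x - y))
    (by fun_prop) (hρc.comp_homeomorph (Homeomorph.subLeft x))

lemma contDiff_conv {ρ g : E → ℝ} (hρ : IsTestFunction ρ) (hg : LocallyIntegrable g) :
    ContDiff ℝ ∞ (conv ρ g) :=
  hρ.2.contDiff_convolution_left _ (n := ⊤) hρ.1 hg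

lemma partialDeriv_conv {ρ g : E → ℝ} (hρ : IsTestFunction ρ) (hg : LocallyIntegrable g)
    (i : Fin n) : D i (conv ρ g) = conv (D i ρ) g := by
  ext x
  have h := hρ.2.hasFDerivAt_convolution_left (ContinuousLinearMap.lsmul ℝ ℝ)
    (hρ.1.of_le (by simp)) hg x
  rw [partialDeriv, conv, h.fderiv, convolution_def, ContinuousLinearMap.integral_apply]
  · rfl
  · exact (hρ.2.fderiv (𝕜 := ℝ)).convolutionExists_left _
      (hρ.1.continuous_fderiv (by simp)) hg x

lemma partialDeriv_comp_const_sub {ρ : E → ℝ} (hρ : ContDiff ℝ ∞ ρ) (x : E) (i : Fin n) :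
    D i (fun y => ρ (x - y)) = fun y => -D i ρ (x - y) := by
  ext y
  have := ((hρ.hasFDerivAt_infty (x - y)).comp y ((hasFDerivAt_id y).const_sub x)).fderiv
  simp only [partialDeriv]
  change fderiv ℝ (ρ ∘ HSub.hSub x) y _ = _
  rw [this]
  simp

lemma IsTestFunction.comp_const_sub {ρ : E → ℝ} (hρ : IsTestFunction ρ) (x : E) :
    IsTestFunction fun y => ρ (x - y) :=
  ⟨hρ.1.comp (contDiff_const.sub contDiff_id), hρ.2.comp_homeomorph (Homeomorph.subLeft x)⟩

lemma isTestFunction_normed (φ : ContDiffBump (0 : E)) : IsTestFunction (φ.normed volume) :=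
  ⟨φ.contDiff_normed (n := ⊤), φ.hasCompactSupport_normed⟩

lemma abs_conv_normed_le (φ : ContDiffBump (0 : E)) (g : E → ℝ) (x : E) :
    |conv (φ.normed volume) g x| ≤ conv (φ.normed volume) (fun y => |g y|) x := by
  rw [conv_apply, conv_apply]
  refine (abs_integral_le_integral_abs).trans_eq ?_
  simp [abs_mul, abs_of_nonneg (φ.nonneg_normed _)]

lemma conv_normed_sq_le (φ : ContDiffBump (0 : E)) {g : E → ℝ} (hg : LocallyIntegrable g)
    (hg2 : LocallyIntegrable fun y => g y ^ 2) (x : E) :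
    conv (φ.normed volume) g x ^ 2 ≤ conv (φ.normed volume) (fun y => g y ^ 2) x := by
  have hρ := isTestFunction_normed φ
  have i0 := integrable_conv_integrand hρ.1.continuous hρ.2 (g := fun _ : E => (1 : ℝ))
    (locallyIntegrable_const _) x
  have i1 := integrable_conv_integrand hρ.1.continuous hρ.2 hg x
  have i2 := integrable_conv_integrand hρ.1.continuous hρ.2 hg2 x
  have h1 : ∫ y, φ.normed volume (x - y) * 1 = 1 := by
    simp only [mul_one]
    rw [integral_sub_left_eq_self (φ.normed volume) volume x, φ.integral_normed]
  rw [conv_apply, conv_apply]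
  set m := ∫ y, φ.normed volume (x - y) * g y with hm
  have : 0 ≤ ∫ y, φ.normed volume (x - y) * (g y - m) ^ 2 :=
    integral_nonneg fun y => mul_nonneg (φ.nonneg_normed _) (sq_nonneg _)
  have e : ∀ y, φ.normed volume (x - y) * (g y - m) ^ 2 = φ.normed volume (x - y) * g y ^ 2
      - 2 * m * (φ.normed volume (x - y) * g y) + m ^ 2 * (φ.normed volume (x - y) * 1) := by
    intro y; ring
  simp only [e] at this
  rw [integral_add (f := fun y => _ - _) (i2.sub (i1.const_mul _)) (i0.const_mul _),
    integral_sub i2 (i1.const_mul _), integral_const_mul, integral_const_mul, h1, ← hm] at this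
  linarith

lemma integrable_conv_normed_sq (φ : ContDiffBump (0 : E)) {g : E → ℝ}
    (hg : LocallyIntegrable g) (hg2 : Integrable fun y => g y ^ 2) :
    Integrable (fun x => conv (φ.normed volume) g x ^ 2) ∧
      ∫ x, conv (φ.normed volume) g x ^ 2 ≤ ∫ x, g x ^ 2 := by
  have hρ := isTestFunction_normed φ
  have h1 : Integrable (conv (φ.normed volume) fun y => g y ^ 2) :=
    φ.integrable_normed.integrable_convolution _ hg2
  have h2 : Integrable (fun x => conv (φ.normed volume) g x ^ 2) := by
    refine h1.mono' ((contDiff_conv hρ hg).continuous.pow 2).aestronglyMeasurable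
      (ae_of_all _ fun x => ?_)
    rw [Real.norm_of_nonneg (sq_nonneg _)]
    exact conv_normed_sq_le φ hg hg2.locallyIntegrable x
  refine ⟨h2, (integral_mono h2 h1 fun x =>
    conv_normed_sq_le φ hg hg2.locallyIntegrable x).trans_eq ?_⟩
  have := integral_convolution (ContinuousLinearMap.lsmul ℝ ℝ) (μ := volume) (ν := volume)
    (φ.integrable_normed (μ := (volume : Measure E))) hg2
  rw [φ.integral_normed] at this
  simpa [conv] using this

lemma tendsto_integral_conv_normed_mul {φ : ℕ → ContDiffBump (0 : E)}
    (hφ : Tendsto (fun k => (φ k).rOut) atTop (𝓝 0)) {g ψ : E → ℝ} (hg : LocallyIntegrable g)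
    (hψ : Continuous ψ) (hψc : HasCompactSupport ψ) :
    Tendsto (fun k => ∫ x, conv ((φ k).normed volume) g x * ψ x) atTop
      (𝓝 (∫ x, g x * ψ x)) := by
  set ψ' : E → ℝ := fun x => ψ (-x) with hψ'
  have hψ'0 : Continuous ψ' := by fun_prop
  have hψ'c : HasCompactSupport ψ' := hψc.comp_homeomorph (Homeomorph.neg E)
  have e : ∀ a : E → ℝ, ∫ x, a x * ψ x = conv a ψ' 0 := by
    intro a
    rw [conv, convolution_def]
    simp [hψ']
  simp only [e]
  have hc : Continuous (conv g ψ') := hψ'c.continuous_convolution_right _ hg hψ'0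
  have hassoc : ∀ k, conv (conv ((φ k).normed volume) g) ψ' 0
      = conv ((φ k).normed volume) (conv g ψ') 0 := by
    intro k
    have hρ := isTestFunction_normed (φ k)
    refine convolution_assoc (ContinuousLinearMap.lsmul ℝ ℝ) (ContinuousLinearMap.lsmul ℝ ℝ)
      (ContinuousLinearMap.lsmul ℝ ℝ) (ContinuousLinearMap.lsmul ℝ ℝ)
      (fun x y z => by simp [mul_assoc]) hρ.1.continuous.aestronglyMeasurable
      hg.aestronglyMeasurable hψ'0.aestronglyMeasurable
      (ae_of_all _ (hρ.2.convolutionExists_left _ hρ.1.continuous hg))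
      (ae_of_all _ (hψ'c.norm.convolutionExists_right _ (fun x => (hg x).norm) hψ'0.norm))
      (hρ.2.norm.convolutionExists_left _ hρ.1.continuous.norm ?_ 0)
    exact (hψ'c.norm.continuous_convolution_right _ (fun x => (hg x).norm)
      hψ'0.norm).locallyIntegrable
  simp only [hassoc]
  exact ContDiffBump.convolution_tendsto_right_of_continuous hφ hc 0

lemma ae_eq_const_of_integral_mul_partialDeriv_eq_zero {h : E → ℝ} (hh : LocallyIntegrable h)
    (hD : ∀ ψ : E → ℝ, IsTestFunction ψ → ∀ i, ∫ x, h x * D i ψ x = 0) :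
    ∃ c, ∀ᵐ x, h x = c := by
  set φ : ℕ → ContDiffBump (0 : E) := fun k =>
    ⟨1 / (k + 1), 2 * (1 / (k + 1)), by positivity, by
      have : (0 : ℝ) < 1 / (k + 1) := by positivity
      linarith⟩ with hφdef
  have hφ : Tendsto (fun k => (φ k).rOut) atTop (𝓝 0) := by
    have := (tendsto_one_div_add_atTop_nhds_zero_nat (𝕜 := ℝ)).const_mul 2
    rwa [mul_zero] at this
  have hae := ContDiffBump.ae_convolution_tendsto_right_of_locallyIntegrable (μ := volume)
    hφ (K := 2) (Eventually.of_forall fun k => le_rfl) hh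
  have hconst : ∀ k x, conv ((φ k).normed volume) h x = conv ((φ k).normed volume) h 0 := by
    intro k x
    have hρ := isTestFunction_normed (φ k)
    refine is_const_of_fderiv_eq_zero (𝕜 := ℝ)
      ((contDiff_conv hρ hh).differentiable (by simp)) (fun y => ?_) x 0
    rw [← norm_eq_zero, ← sq_eq_zero_iff, norm_fderiv_sq_eq_sum_partialDeriv_sq]
    refine Finset.sum_eq_zero fun i _ => ?_
    rw [partialDeriv_conv hρ hh, conv_apply]
    have := hD _ (hρ.comp_const_sub y) i
    rw [partialDeriv_comp_const_sub hρ.1] at this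
    simp only [mul_neg, integral_neg, neg_eq_zero] at this
    simp [mul_comm, this]

  obtain ⟨x₀, hx₀⟩ := hae.exists
  refine ⟨h x₀, hae.mono fun x hx => tendsto_nhds_unique hx ?_⟩
  refine hx₀.congr fun k => ?_
  exact (hconst k x₀).trans (hconst k x).symm

lemma sq_integral_mul_le {α : Type*} [MeasurableSpace α] {μ : Measure α} {a b : α → ℝ}
    (ha : Integrable (fun x => a x ^ 2) μ) (hb : Integrable (fun x => b x ^ 2) μ)
    (hab : Integrable (fun x => a x * b x) μ) :
    (∫ x, a x * b x ∂μ) ^ 2 ≤ (∫ x, a x ^ 2 ∂μ) * ∫ x, b x ^ 2 ∂μ := by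
  have key : ∀ t : ℝ, 0 ≤ (∫ x, a x ^ 2 ∂μ) * (t * t) + (2 * ∫ x, a x * b x ∂μ) * t
      + ∫ x, b x ^ 2 ∂μ := by
    intro t
    have h : 0 ≤ ∫ x, (t * a x + b x) ^ 2 ∂μ := integral_nonneg fun x => sq_nonneg _
    have e : ∀ x, (t * a x + b x) ^ 2 = t * t * a x ^ 2 + 2 * t * (a x * b x) + b x ^ 2 :=
      fun x => by ring
    simp only [e] at h
    rw [integral_add (f := fun x => _ + _) ((ha.const_mul _).add (hab.const_mul _)) hb,
      integral_add (ha.const_mul _) (hab.const_mul _), integral_const_mul,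
      integral_const_mul] at h
    linarith
  have := discrim_le_zero key
  rw [discrim] at this
  linarith

lemma exists_cutoff {B : ℝ} (hB : 0 < B) {K : Set E} (hK : IsCompact K) :
    ∃ χ : E → ℝ, IsTestFunction χ ∧ (∀ x, 0 ≤ χ x) ∧ (∀ x, χ x ≤ 1) ∧ (∀ x ∈ K, χ x = 1) ∧
      ∀ x, ∑ i, D i χ x ^ 2 ≤ B := by
  let φ : ContDiffBump (0 : E) := ⟨1, 2, one_pos, one_lt_two⟩
  have hφ : ContDiff ℝ ∞ φ := φ.contDiff (n := ⊤)
  obtain ⟨C, hC⟩ := (φ.hasCompactSupport.fderiv (𝕜 := ℝ)).exists_bound_of_continuous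
    (hφ.continuous_fderiv (by simp))
  obtain ⟨R, hR⟩ := hK.isBounded.subset_closedBall (0 : E)
  have h1 : ∀ᶠ c : ℝ in 𝓝[>] 0, c * R ≤ 1 := by
    have : Tendsto (fun c : ℝ => c * R) (𝓝[>] 0) (𝓝 (0 * R)) :=
      ((continuous_id.mul continuous_const).tendsto 0).mono_left nhdsWithin_le_nhds
    rw [zero_mul] at this
    exact this.eventually (eventually_le_nhds one_pos)
  have h2 : ∀ᶠ c : ℝ in 𝓝[>] 0, (c * C) ^ 2 ≤ B := by
    have : Tendsto (fun c : ℝ => (c * C) ^ 2) (𝓝[>] 0) (𝓝 ((0 * C) ^ 2)) :=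
      (((continuous_id.mul continuous_const).pow 2).tendsto 0).mono_left nhdsWithin_le_nhds
    rw [zero_mul, zero_pow two_ne_zero] at this
    exact this.eventually (eventually_le_nhds hB)
  obtain ⟨c, h1, h2, hc⟩ := (h1.and (h2.and self_mem_nhdsWithin)).exists
  have hc : 0 < c := hc
  refine ⟨fun x => φ (c • x), ⟨hφ.comp (contDiff_const_smul c),
    φ.hasCompactSupport.comp_homeomorph (Homeomorph.smulOfNeZero c hc.ne')⟩,
    fun x => φ.nonneg, fun x => φ.le_one, fun x hx => φ.one_of_mem_closedBall ?_, fun x => ?_⟩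
  · have := hR hx
    rw [mem_closedBall_zero_iff] at this ⊢
    rw [norm_smul, Real.norm_of_nonneg hc.le]
    exact (mul_le_mul_of_nonneg_left this hc.le).trans h1
  · rw [← norm_fderiv_sq_eq_sum_partialDeriv_sq, fderiv_comp_smul, norm_smul,
      Real.norm_of_nonneg hc.le]
    refine le_trans ?_ h2
    gcongr
    exact hC _

/-- The potential of the Schrödinger operator unitarily equivalent to `diffusionOp U`. -/
noncomputable def schrodingerPotential (U : E → ℝ) (x : E) : ℝ :=
  ∑ i, (D i U x ^ 2 / 4 - D i (D i U) x / 2)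

lemma continuous_schrodingerPotential {U : E → ℝ} (hU : ContDiff ℝ ∞ U) :
    Continuous (schrodingerPotential U) :=
  continuous_finsetSum _ fun i _ => (((hU.continuous_partialDeriv i).pow 2).div_const _).sub
    (((hU.partialDeriv i).continuous_partialDeriv i).div_const _)

lemma contDiff_exp_half_mul {U v : E → ℝ} (hU : ContDiff ℝ ∞ U) (hv : ContDiff ℝ ∞ v) :
    ContDiff ℝ ∞ fun x => exp (1 / 2 * U x) * v x :=
  (contDiff_const.mul hU).exp.mul hv

lemma diffusionOp_exp_half_mul {U v : E → ℝ} (hU : ContDiff ℝ ∞ U) (hv : ContDiff ℝ ∞ v)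
    (x : E) : diffusionOp U (fun x => exp (1 / 2 * U x) * v x) x
      = exp (1 / 2 * U x) * (∑ i, D i (D i v) x - schrodingerPotential U x * v x) := by
  have he : ContDiff ℝ ∞ fun x => exp (1 / 2 * U x) := (contDiff_const.mul hU).exp
  have h1 : ∀ i, D i (fun x => exp (1 / 2 * U x) * v x)
      = fun x => exp (1 / 2 * U x) * (D i v x + 1 / 2 * (D i U x * v x)) := fun i => by
    rw [partialDeriv_mul he hv, partialDeriv_exp_const_mul hU]
    ext x; ring
  have hw : ∀ i, ContDiff ℝ ∞ fun x => 1 / 2 * (D i U x * v x) := fun i =>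
    contDiff_const.mul ((hU.partialDeriv i).mul hv)
  have h2 : ∀ i, partialAdj U i (D i (fun x => exp (1 / 2 * U x) * v x)) x
      = exp (1 / 2 * U x) * ((D i U x ^ 2 / 4 - D i (D i U) x / 2) * v x - D i (D i v) x) := by
    intro i
    rw [partialAdj, h1, partialDeriv_mul he ((hv.partialDeriv i).add (hw i)),
      partialDeriv_exp_const_mul hU, partialDeriv_add (hv.partialDeriv i) (hw i),
      partialDeriv_const_mul ((hU.partialDeriv i).mul hv),
      partialDeriv_mul (hU.partialDeriv i) hv]
    ring
  simp only [diffusionOp, h2, schrodingerPotential]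
  rw [← Finset.mul_sum, Finset.sum_sub_distrib, ← Finset.sum_mul]
  ring

lemma integral_caccioppoli {U : E → ℝ} [IsProbabilityMeasure (gibbsMeasure U)]
    (hU : ContDiff ℝ ∞ U) {h χ : E → ℝ} (hh : ContDiff ℝ ∞ h) (hχ : IsTestFunction χ) :
    ∫ x, χ x ^ 2 * ∑ i, D i h x ^ 2 ∂gibbsMeasure U
      ≤ ∫ x, (4 * (∑ i, D i χ x ^ 2) * h x ^ 2 - 2 * χ x ^ 2 * (h x * diffusionOp U h x))
        ∂gibbsMeasure U := by
  have hL := contDiff_diffusionOp hU hh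
  have hχ2 : IsTestFunction fun x => χ x ^ 2 := by
    simpa only [pow_two] using IsTestFunction.mul_left hχ.1 hχ
  have hχD : ∀ i, D i (fun x => χ x ^ 2) = fun x => 2 * χ x * D i χ x := fun i => by
    simp only [pow_two]
    rw [partialDeriv_mul hχ.1 hχ.1]
    ext x; ring
  have hf : IsTestFunction fun x => h x * χ x ^ 2 := IsTestFunction.mul_left hh hχ2
  have key := integral_mul_diffusionOp hU hf.1 hh (Or.inl hf.2)
  have hi : ∀ i, Integrable (fun x => D i (fun x => h x * χ x ^ 2) x * D i h x)
      (gibbsMeasure U) := fun i => IsTestFunction.integrable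
    ⟨(hf.1.partialDeriv i).mul (hh.partialDeriv i), (hf.2.partialDeriv i).mul_right⟩
  rw [← integral_finsetSum _ fun i _ => hi i] at key
  have iA : Integrable (fun x => χ x ^ 2 * ∑ i, D i h x ^ 2) (gibbsMeasure U) :=
    IsTestFunction.integrable ⟨hχ2.1.mul (ContDiff.sum fun i _ => (hh.partialDeriv i).pow 2),
      hχ2.2.mul_right⟩
  have iB : Integrable (fun x => 4 * (∑ i, D i χ x ^ 2) * h x ^ 2) (gibbsMeasure U) := by
    have : IsTestFunction fun x => ∑ i, D i χ x ^ 2 := IsTestFunction.sum _ fun i _ => by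
      simpa only [pow_two] using IsTestFunction.mul_left (hχ.1.partialDeriv i) (hχ.partialDeriv i)
    exact IsTestFunction.integrable ⟨(contDiff_const.mul this.1).mul (hh.pow 2),
      (this.2.mul_left).mul_right⟩
  have iC : Integrable (fun x => h x * χ x ^ 2 * diffusionOp U h x) (gibbsMeasure U) :=
    IsTestFunction.integrable ⟨hf.1.mul hL, hf.2.mul_right⟩
  have e : ∀ x, 4 * (∑ i, D i χ x ^ 2) * h x ^ 2 - 2 * χ x ^ 2 * (h x * diffusionOp U h x)
      = 4 * (∑ i, D i χ x ^ 2) * h x ^ 2 - 2 * (h x * χ x ^ 2 * diffusionOp U h x) :=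
    fun x => by ring
  simp only [e]
  rw [integral_sub iB (iC.const_mul 2), integral_const_mul, key, mul_neg, sub_neg_eq_add,
    ← integral_const_mul, ← integral_add iB ((integrable_finsetSum _ fun i _ => hi i).const_mul 2)]
  refine integral_mono iA (iB.add ((integrable_finsetSum _ fun i _ => hi i).const_mul 2))
    fun x => ?_
  simp only [Finset.mul_sum, Finset.sum_mul, ← Finset.sum_add_distrib]
  refine Finset.sum_le_sum fun i _ => ?_
  rw [partialDeriv_mul hh hχ2.1, hχD]
  nlinarith [sq_nonneg (χ x * D i h x + 2 * (D i χ x * h x))]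

/-- `g` is a weak solution of the Schrödinger equation `Δ g = V g` with potential
`V = schrodingerPotential U`. -/
def IsWeakSolution (U g : E → ℝ) : Prop :=
  ∀ v : E → ℝ, IsTestFunction v →
    ∫ x, (∑ i, D i (D i v) x - schrodingerPotential U x * v x) * g x = 0

lemma abs_diffusionOp_exp_half_mul_conv_le {U g : E → ℝ} (hU : ContDiff ℝ ∞ U)
    (hg : LocallyIntegrable g) (hw : IsWeakSolution U g) (φ : ContDiffBump (0 : E)) {x : E}
    {η : ℝ} (hη : ∀ y, dist y x < φ.rOut →
      |schrodingerPotential U y - schrodingerPotential U x| ≤ η) :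
    |diffusionOp U (fun x => exp (1 / 2 * U x) * conv (φ.normed volume) g x) x|
      ≤ exp (1 / 2 * U x) * (η * conv (φ.normed volume) (fun y => |g y|) x) := by
  set ρ := φ.normed volume with hρdef
  have hρ : IsTestFunction ρ := isTestFunction_normed φ
  set V := schrodingerPotential U with hV
  have hVc : Continuous V := continuous_schrodingerPotential hU
  have hDD : ∀ i, D i (D i fun y => ρ (x - y)) = fun y => D i (D i ρ) (x - y) := fun i => by
    have h := partialDeriv_comp_const_sub (hρ.1.partialDeriv i) x i
    rw [partialDeriv_comp_const_sub hρ.1]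
    have h0 := partialDeriv_const_mul (((hρ.partialDeriv i).comp_const_sub x).1) (-1) i
    simp only [neg_one_mul] at h0
    rw [h0, h]
    simp
  have hgV : LocallyIntegrable fun y => V y * g y := hg.continuous_mul hVc
  have i1 : ∀ i, Integrable fun y => D i (D i ρ) (x - y) * g y := fun i =>
    integrable_conv_integrand ((hρ.1.partialDeriv i).continuous_partialDeriv i)
      ((hρ.2.partialDeriv i).partialDeriv i) hg x
  have i2 : Integrable fun y => ρ (x - y) * (V y * g y) :=
    integrable_conv_integrand hρ.1.continuous hρ.2 hgV x
  have i3 : Integrable fun y => ρ (x - y) * g y :=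
    integrable_conv_integrand hρ.1.continuous hρ.2 hg x
  have hga : LocallyIntegrable fun y => |g y| := fun z => (hg z).norm
  have i4 : Integrable fun y => ρ (x - y) * |g y| :=
    integrable_conv_integrand hρ.1.continuous hρ.2 hga x
  have h0 := hw _ (hρ.comp_const_sub x)
  simp only [hDD] at h0
  have e0 : ∀ y, (∑ i, D i (D i ρ) (x - y) - V y * ρ (x - y)) * g y
      = ∑ i, D i (D i ρ) (x - y) * g y - ρ (x - y) * (V y * g y) := fun y => by
    rw [sub_mul, Finset.sum_mul]; ring
  simp only [← hV, e0] at h0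
  rw [integral_sub (integrable_finsetSum _ fun i _ => i1 i) i2,
    integral_finsetSum _ fun i _ => i1 i, sub_eq_zero] at h0
  have hsum : ∑ i, D i (D i (conv ρ g)) x = ∫ y, ρ (x - y) * (V y * g y) := by
    rw [← h0]
    refine Finset.sum_congr rfl fun i _ => ?_
    rw [partialDeriv_conv hρ hg, partialDeriv_conv (hρ.partialDeriv i) hg, conv_apply]
  rw [diffusionOp_exp_half_mul hU (contDiff_conv hρ hg), hsum, abs_mul,
    abs_of_pos (exp_pos _), conv_apply ρ g, ← integral_const_mul, ← integral_sub i2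
      (i3.const_mul _), conv_apply, ← integral_const_mul]
  refine mul_le_mul_of_nonneg_left ?_ (exp_nonneg _)
  refine abs_integral_le_integral_abs.trans (integral_mono (i2.sub (i3.const_mul _)).abs
    (i4.const_mul _) fun y => ?_)
  have hρ0 : 0 ≤ ρ (x - y) := φ.nonneg_normed _
  rw [show ρ (x - y) * (V y * g y) - V x * (ρ (x - y) * g y)
    = ρ (x - y) * ((V y - V x) * g y) by ring, abs_mul, abs_mul, abs_of_nonneg hρ0]
  by_cases hy : dist y x < φ.rOut
  · have := mul_le_mul_of_nonneg_left
      (mul_le_mul_of_nonneg_right (hη y hy) (abs_nonneg (g y))) hρ0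
    linarith
  · have : ρ (x - y) = 0 := by
      have : x - y ∉ Function.support ρ := by
        rw [hρdef, φ.support_normed_eq, mem_ball_zero_iff, ← dist_eq_norm, dist_comm]
        exact hy
      simpa using this
    simp [this]

lemma integral_sq_mul_sum_partialDeriv_sq_conv_le {U g : E → ℝ}
    [IsProbabilityMeasure (gibbsMeasure U)] (hU : ContDiff ℝ ∞ U)
    (hg : LocallyIntegrable g) (hg2 : Integrable fun x => g x ^ 2) (hw : IsWeakSolution U g)
    (φ : ContDiffBump (0 : E)) {χ : E → ℝ} (hχ : IsTestFunction χ) (hχ1 : ∀ x, |χ x| ≤ 1)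
    {B : ℝ} (hχB : ∀ x, ∑ i, D i χ x ^ 2 ≤ B)
    {η : ℝ} (hη0 : 0 ≤ η) (hη : ∀ x ∈ tsupport χ, ∀ y, dist y x < φ.rOut →
      |schrodingerPotential U y - schrodingerPotential U x| ≤ η) :
    ∫ x, χ x ^ 2 * ∑ i, D i (fun x => exp (1 / 2 * U x) * conv (φ.normed volume) g x) x ^ 2
      ∂gibbsMeasure U ≤ (4 * B + 2 * η) * ∫ x, g x ^ 2 := by
  set ρ := φ.normed volume with hρdef
  have hρ : IsTestFunction ρ := isTestFunction_normed φ
  have hB : 0 ≤ B := (Finset.sum_nonneg fun i _ => sq_nonneg _).trans (hχB 0)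
  set h : E → ℝ := fun x => exp (1 / 2 * U x) * conv ρ g x with hh
  have hhs : ContDiff ℝ ∞ h := contDiff_exp_half_mul hU (contDiff_conv hρ hg)
  have hga : LocallyIntegrable fun y => |g y| := fun z => (hg z).norm
  obtain ⟨i1, l1⟩ := integrable_conv_normed_sq φ hg hg2
  obtain ⟨i2, l2⟩ := integrable_conv_normed_sq φ hga (by simpa only [sq_abs] using hg2)
  simp only [sq_abs, ← hρdef] at i1 i2 l1 l2
  refine (integral_caccioppoli hU hhs hχ).trans ?_
  rw [integral_gibbsMeasure hU.continuous]
  have hbound : ∀ x, (4 * (∑ i, D i χ x ^ 2) * h x ^ 2 - 2 * χ x ^ 2 * (h x * diffusionOp U h x))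
      * exp (-U x) ≤ 4 * B * conv ρ g x ^ 2 + 2 * η * conv ρ (fun y => |g y|) x ^ 2 := by
    intro x
    set a := exp (1 / 2 * U x) with ha
    have ha0 : 0 < a := exp_pos _
    have hae : a * a * exp (-U x) = 1 := by
      rw [ha, ← exp_add, ← exp_add]; simp; ring
    have h1 : 4 * (∑ i, D i χ x ^ 2) * h x ^ 2 * exp (-U x) ≤ 4 * B * conv ρ g x ^ 2 := by
      have : 4 * (∑ i, D i χ x ^ 2) * h x ^ 2 * exp (-U x)
          = 4 * (∑ i, D i χ x ^ 2) * conv ρ g x ^ 2 * (a * a * exp (-U x)) := by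
        simp only [hh]; ring
      rw [this, hae, mul_one]
      gcongr
      exact hχB x
    have h2 : -(2 * χ x ^ 2 * (h x * diffusionOp U h x)) * exp (-U x)
        ≤ 2 * η * conv ρ (fun y => |g y|) x ^ 2 := by
      have hca : |conv ρ g x| ≤ conv ρ (fun y => |g y|) x := abs_conv_normed_le φ g x
      have hc0 := (abs_nonneg _).trans hca
      by_cases hx : x ∈ tsupport χ
      · have hL : |diffusionOp U h x| ≤ a * (η * conv ρ (fun y => |g y|) x) :=
          abs_diffusionOp_exp_half_mul_conv_le hU hg hw φ (hη x hx)
        have hχ2 : χ x ^ 2 ≤ 1 := by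
          rw [← sq_abs]; exact pow_le_one₀ (abs_nonneg _) (hχ1 x)
        have hhx : |h x| ≤ a * conv ρ (fun y => |g y|) x := by
          simp only [hh]
          rw [abs_mul, abs_of_pos ha0]
          exact mul_le_mul_of_nonneg_left hca ha0.le
        have hmul : -(h x * diffusionOp U h x)
            ≤ (a * conv ρ (fun y => |g y|) x) * (a * (η * conv ρ (fun y => |g y|) x)) := by
          refine (neg_le_abs _).trans ?_
          rw [abs_mul]
          exact mul_le_mul hhx hL (abs_nonneg _) (by positivity)
        calc -(2 * χ x ^ 2 * (h x * diffusionOp U h x)) * exp (-U x)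
            = 2 * χ x ^ 2 * (-(h x * diffusionOp U h x)) * exp (-U x) := by ring
          _ ≤ 2 * χ x ^ 2 * ((a * conv ρ (fun y => |g y|) x)
              * (a * (η * conv ρ (fun y => |g y|) x))) * exp (-U x) := by gcongr
          _ = 2 * χ x ^ 2 * (η * conv ρ (fun y => |g y|) x ^ 2) * (a * a * exp (-U x)) := by
            ring
          _ ≤ 2 * 1 * (η * conv ρ (fun y => |g y|) x ^ 2) * 1 := by
            rw [hae]; gcongr
          _ = _ := by ring
      · rw [image_eq_zero_of_notMem_tsupport hx]
        simp only [ne_eq, OfNat.ofNat_ne_zero, not_false_eq_true, zero_pow, mul_zero, zero_mul,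
          neg_zero]
        positivity
    rw [sub_mul]
    linarith
  have hcont : Continuous fun x => (4 * (∑ i, D i χ x ^ 2) * h x ^ 2
      - 2 * χ x ^ 2 * (h x * diffusionOp U h x)) * exp (-U x) :=
    (((continuous_const.mul (continuous_finsetSum _ fun i _ =>
      (hχ.1.continuous_partialDeriv i).pow 2)).mul (hhs.continuous.pow 2)).sub
      ((continuous_const.mul (hχ.1.continuous.pow 2)).mul (hhs.continuous.mul
        (contDiff_diffusionOp hU hhs).continuous))).mul hU.continuous.neg.rexp
  have hsupp : HasCompactSupport fun x => (4 * (∑ i, D i χ x ^ 2) * h x ^ 2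
      - 2 * χ x ^ 2 * (h x * diffusionOp U h x)) * exp (-U x) := by
    refine HasCompactSupport.intro hχ.2 fun x hx => ?_
    have h1 : ∀ i, D i χ x = 0 := fun i => by
      rw [partialDeriv, image_eq_zero_of_notMem_tsupport fun h => hx (tsupport_fderiv_subset ℝ h)]
      rfl
    simp [h1, image_eq_zero_of_notMem_tsupport hx]
  refine (integral_mono (hcont.integrable_of_hasCompactSupport hsupp)
    ((i1.const_mul _).add (i2.const_mul _)) hbound).trans ?_
  rw [integral_add' (i1.const_mul _) (i2.const_mul _), integral_const_mul, integral_const_mul,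
    add_mul]
  gcongr

lemma integral_exp_half_mul_partialDeriv_eq_zero {U g : E → ℝ}
    [IsProbabilityMeasure (gibbsMeasure U)] (hU : ContDiff ℝ ∞ U)
    (hg : LocallyIntegrable g) (hg2 : Integrable fun x => g x ^ 2) (hw : IsWeakSolution U g)
    {ψ : E → ℝ} (hψ : IsTestFunction ψ) (i : Fin n) :
    ∫ x, g x * (exp (1 / 2 * U x) * D i ψ x) = 0 := by
  have he : ∀ c : ℝ, ContDiff ℝ ∞ fun x => exp (c * U x) := fun c =>
    (contDiff_const.mul hU).exp
  set P := ∫ x, (ψ x * exp (1 / 2 * U x)) ^ 2 with hP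
  set N := ∫ x, g x ^ 2 with hN
  have hP0 : 0 ≤ P := integral_nonneg fun x => sq_nonneg _
  have hN0 : 0 ≤ N := integral_nonneg fun x => sq_nonneg _
  have key : ∀ ε : ℝ, 0 < ε →
      (∫ x, g x * (exp (1 / 2 * U x) * D i ψ x)) ^ 2 ≤ 6 * ε * N * P := by
    intro ε hε
    obtain ⟨χ, hχ, hχ0, hχ1, hχK, hχB⟩ := exists_cutoff hε hψ.2.isCompact
    obtain ⟨δ, hδ, hδV⟩ : ∃ δ > 0, ∀ x ∈ tsupport χ, ∀ y, dist y x < δ →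
        |schrodingerPotential U y - schrodingerPotential U x| ≤ ε := by
      have := hχ.2.isCompact.uniformContinuousAt_of_continuousAt (schrodingerPotential U)
        (fun x _ => (continuous_schrodingerPotential hU).continuousAt)
        (Metric.dist_mem_uniformity hε)
      obtain ⟨δ, hδ, h⟩ := Metric.mem_uniformity_dist.1 this
      refine ⟨δ, hδ, fun x hx y hxy => ?_⟩
      have := h (dist_comm y x ▸ hxy) hx
      rw [abs_sub_comm, ← Real.dist_eq]
      exact (show dist _ _ < ε from this).le
    set φ : ℕ → ContDiffBump (0 : E) := fun k =>
      ⟨δ * (1 / (k + 1)) / 2, δ * (1 / (k + 1)), by positivity, by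
        have : (0 : ℝ) < δ * (1 / (k + 1)) := by positivity
        linarith⟩ with hφdef
    have hφ : Tendsto (fun k => (φ k).rOut) atTop (𝓝 0) := by
      have := (tendsto_one_div_add_atTop_nhds_zero_nat (𝕜 := ℝ)).const_mul δ
      rwa [mul_zero] at this
    have hφδ : ∀ k, (φ k).rOut ≤ δ := fun k => by
      change δ * (1 / ((k : ℝ) + 1)) ≤ δ
      refine mul_le_of_le_one_right hδ.le ?_
      rw [div_le_one (by positivity)]
      linarith [(Nat.cast_nonneg k : (0 : ℝ) ≤ k)]
    have hlim := tendsto_integral_conv_normed_mul hφ hg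
      (((he (1 / 2)).continuous).mul (hψ.1.continuous_partialDeriv i))
      ((hψ.2.partialDeriv i).mul_left)
    simp only [Pi.mul_apply] at hlim
    refine le_of_tendsto (hlim.pow 2) (Eventually.of_forall fun k => ?_)
    set c := conv ((φ k).normed volume) g with hc
    have hcs : ContDiff ℝ ∞ c := contDiff_conv (isTestFunction_normed _) hg
    set h : E → ℝ := fun x => exp (1 / 2 * U x) * c x with hh
    have hhs : ContDiff ℝ ∞ h := contDiff_exp_half_mul hU hcs
    have hA := integral_sq_mul_sum_partialDeriv_sq_conv_le hU hg hg2 hw (φ k) hχ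
      (fun x => by rw [abs_of_nonneg (hχ0 x)]; exact hχ1 x) hχB hε.le
      (fun x hx y hxy => hδV x hx y (hxy.trans_le (hφδ k)))
    rw [← hc, integral_gibbsMeasure hU.continuous, ← hN] at hA
    have e1 : ∫ x, c x * (exp (1 / 2 * U x) * D i ψ x)
        = -∫ x, (χ x * D i h x * exp (-(1 / 2) * U x)) * (ψ x * exp (1 / 2 * U x)) := by
      have := integral_partialDeriv_mul hhs hψ.1 (Or.inr hψ.2) i
      rw [← neg_eq_iff_eq_neg] at this
      have e2 : ∀ x, c x * (exp (1 / 2 * U x) * D i ψ x) = h x * D i ψ x := fun x => by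
        simp only [hh]; ring
      simp only [e2]
      rw [← this]
      congr 1
      refine integral_congr_ae (ae_of_all _ fun x => ?_)
      by_cases hx : x ∈ tsupport ψ
      · have : exp (-(1 / 2) * U x) * exp (1 / 2 * U x) = 1 := by
          rw [← exp_add]; simp
        simp only [hχK x hx]
        linear_combination (-D i h x * ψ x) * this
      · simp [image_eq_zero_of_notMem_tsupport hx]
    have ha : IsTestFunction fun x => χ x * D i h x * exp (-(1 / 2) * U x) :=
      ⟨(hχ.1.mul (hhs.partialDeriv i)).mul (he _), hχ.2.mul_right.mul_right⟩
    have hb : IsTestFunction fun x => ψ x * exp (1 / 2 * U x) :=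
      ⟨hψ.1.mul (he _), hψ.2.mul_right⟩
    have hsq : ∀ {u : E → ℝ}, IsTestFunction u → Integrable fun x => u x ^ 2 := fun hu => by
      simpa only [pow_two] using (IsTestFunction.mul_left hu.1 hu).integrable (μ := volume)
    rw [e1, neg_sq]
    refine (sq_integral_mul_le (hsq ha) (hsq hb)
      (IsTestFunction.mul_left ha.1 hb).integrable).trans ?_
    rw [← hP]
    refine mul_le_mul_of_nonneg_right ?_ hP0
    refine le_trans ?_ (hA.trans_eq (by ring))
    have hF : IsTestFunction fun x => χ x ^ 2 * (∑ i, D i h x ^ 2) * exp (-U x) :=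
      ⟨((hχ.1.pow 2).mul (ContDiff.sum fun i _ => (hhs.partialDeriv i).pow 2)).mul
        hU.neg.exp, by
        refine HasCompactSupport.intro hχ.2 fun x hx => ?_
        simp [image_eq_zero_of_notMem_tsupport hx]⟩
    refine integral_mono (hsq ha) hF.integrable fun x => ?_
    have hexp : exp (-(1 / 2) * U x) ^ 2 = exp (-U x) := by
      rw [← exp_nat_mul]; congr 1; push_cast; ring
    simp only [mul_pow, hexp]
    gcongr
    exact Finset.single_le_sum (f := fun i => D i h x ^ 2) (fun i _ => sq_nonneg _)
      (Finset.mem_univ i)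
  refine pow_eq_zero_iff two_ne_zero |>.1 (le_antisymm ?_ (sq_nonneg _))
  have hlim : Tendsto (fun ε : ℝ => 6 * ε * N * P) (𝓝[>] 0) (𝓝 (6 * 0 * N * P)) :=
    ((((continuous_const.mul continuous_id).mul continuous_const).mul
      continuous_const).tendsto 0).mono_left nhdsWithin_le_nhds
  simp only [mul_zero, zero_mul] at hlim
  exact ge_of_tendsto hlim (eventually_mem_nhdsWithin.mono fun ε hε => key ε hε)

lemma ae_eq_const_of_isWeakSolution {U g : E → ℝ}
    [IsProbabilityMeasure (gibbsMeasure U)] (hU : ContDiff ℝ ∞ U)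
    (hg : LocallyIntegrable g) (hg2 : Integrable fun x => g x ^ 2) (hw : IsWeakSolution U g) :
    ∃ c, ∀ᵐ x, exp (1 / 2 * U x) * g x = c := by
  refine ae_eq_const_of_integral_mul_partialDeriv_eq_zero
    (hg.continuous_mul (continuous_const.mul hU.continuous).rexp) fun ψ hψ i => ?_
  rw [← integral_exp_half_mul_partialDeriv_eq_zero hU hg hg2 hw hψ i]
  congr with x
  ring

lemma diffusionOp_add {U u v : E → ℝ} (hu : ContDiff ℝ ∞ u) (hv : ContDiff ℝ ∞ v) :
    diffusionOp U (fun x => u x + v x) = fun x => diffusionOp U u x + diffusionOp U v x := by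
  ext x
  have : ∀ i, partialAdj U i (D i fun x => u x + v x) x
      = partialAdj U i (D i u) x + partialAdj U i (D i v) x := fun i => by
    rw [partialDeriv_add hu hv, partialAdj,
      partialDeriv_add (hu.partialDeriv i) (hv.partialDeriv i), partialAdj, partialAdj]
    ring
  simp only [diffusionOp, this, Finset.sum_add_distrib]
  ring

lemma diffusionOp_const_mul {U u : E → ℝ} (hu : ContDiff ℝ ∞ u) (c : ℝ) :
    diffusionOp U (fun x => c * u x) = fun x => c * diffusionOp U u x := by
  ext x
  have : ∀ i, partialAdj U i (D i fun x => c * u x) x = c * partialAdj U i (D i u) x :=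
    fun i => by
      rw [partialDeriv_const_mul hu, partialAdj, partialDeriv_const_mul (hu.partialDeriv i),
        partialAdj]
      ring
  simp only [diffusionOp, this, ← Finset.mul_sum]
  ring

lemma diffusionOp_comp_neg {U u : E → ℝ} (hUeven : ∀ x, U (-x) = U x)
    (hu : ContDiff ℝ ∞ u) :
    diffusionOp U (fun x => u (-x)) = fun x => diffusionOp U u (-x) := by
  ext x
  have hU : ∀ i x, D i U x = -D i U (-x) := fun i x => by
    have := congr_fun (partialDeriv_comp_neg (u := U) i) x
    simpa only [hUeven] using this
  have : ∀ i, partialAdj U i (D i fun x => u (-x)) x = partialAdj U i (D i u) (-x) :=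
    fun i => by
      have hn : ContDiff ℝ ∞ fun x => D i u (-x) := (hu.partialDeriv i).comp contDiff_neg
      have h0 := partialDeriv_const_mul hn (-1) i
      simp only [neg_one_mul] at h0
      rw [partialDeriv_comp_neg, partialAdj, h0, partialDeriv_comp_neg, partialAdj, hU i x]
      ring
  simp only [diffusionOp, this]

lemma isNegInvariant_gibbsMeasure {U : E → ℝ} (hU : Continuous U)
    (hUeven : ∀ x, U (-x) = U x) : (gibbsMeasure U).IsNegInvariant := by
  refine ⟨Measure.ext fun s hs => ?_⟩
  rw [Measure.neg, Measure.map_apply measurable_neg hs, gibbsMeasure,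
    withDensity_apply _ (measurable_neg hs), withDensity_apply _ hs]
  have := (Measure.measurePreserving_neg (volume : Measure E)).setLIntegral_comp_preimage hs
    (f := fun x => ENNReal.ofReal (exp (-U x))) (by fun_prop)
  rw [← this]
  simp only [hUeven]

lemma IsTestFunction.memLp {μ : Measure E} [IsFiniteMeasureOnCompacts μ] {u : E → ℝ}
    (hu : IsTestFunction u) : MemLp u 2 μ :=
  hu.1.continuous.memLp_of_hasCompactSupport hu.2

/-- The classes in `L²` of the functions `diffusionOp U u` for test functions `u`. -/
noncomputable def diffusionOpRange (U : E → ℝ) :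
    Submodule ℝ (Lp ℝ 2 (gibbsMeasure U)) where
  carrier := {F | ∃ u, IsTestFunction u ∧ F =ᵐ[gibbsMeasure U] diffusionOp U u}
  zero_mem' := by
    refine ⟨fun _ => 0, ⟨contDiff_const, HasCompactSupport.zero⟩, ?_⟩
    have := diffusionOp_const_mul (U := U) (u := fun _ : E => 0) contDiff_const 0
    simp only [zero_mul] at this
    rw [this]
    exact Lp.coeFn_zero _ _ _
  add_mem' := by
    rintro F G ⟨u, hu, hF⟩ ⟨v, hv, hG⟩
    refine ⟨fun x => u x + v x, ⟨hu.1.add hv.1, hu.2.add hv.2⟩, ?_⟩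
    rw [diffusionOp_add hu.1 hv.1]
    exact (Lp.coeFn_add F G).trans (hF.add hG)
  smul_mem' := by
    rintro c F ⟨u, hu, hF⟩
    refine ⟨fun x => c * u x, ⟨contDiff_const.mul hu.1, hu.2.mul_left⟩, ?_⟩
    rw [diffusionOp_const_mul hu.1]
    refine (Lp.coeFn_smul c F).trans (hF.mono fun x hx => ?_)
    simp [hx]

lemma ae_eq_const_of_integral_mul_diffusionOp_eq_zero {U : E → ℝ}
    [IsProbabilityMeasure (gibbsMeasure U)] (hU : ContDiff ℝ ∞ U) {h : E → ℝ}
    (hm : StronglyMeasurable h) (hh : MemLp h 2 (gibbsMeasure U))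
    (hL : ∀ u, IsTestFunction u → ∫ x, h x * diffusionOp U u x ∂gibbsMeasure U = 0) :
    ∃ c, ∀ᵐ x ∂gibbsMeasure U, h x = c := by
  set g : E → ℝ := fun x => exp (-(1 / 2) * U x) * h x with hg
  have hexp : ∀ x, exp (1 / 2 * U x) * exp (-(1 / 2) * U x) = 1 := fun x => by
    rw [← exp_add]; simp
  have hexp2 : ∀ x, exp (-U x) = exp (-(1 / 2) * U x) ^ 2 := fun x => by
    rw [← exp_nat_mul]; congr 1; push_cast; ring
  have hg2 : Integrable fun x => g x ^ 2 := by
    have := hh.integrable_sq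
    rw [gibbsMeasure, integrable_withDensity_iff_integrable_smul'
      (by have := hU.continuous; fun_prop) (by simp)] at this
    refine this.congr (ae_of_all _ fun x => ?_)
    simp only [hg, smul_eq_mul]
    rw [ENNReal.toReal_ofReal (exp_nonneg _), hexp2]
    ring
  have hgm : AEStronglyMeasurable g := ((continuous_const.mul
    hU.continuous).rexp.stronglyMeasurable.mul hm).aestronglyMeasurable
  have hgl : LocallyIntegrable g :=
    ((memLp_two_iff_integrable_sq hgm).2 hg2).locallyIntegrable (by norm_num)
  have hw : IsWeakSolution U g := by
    intro v hv
    have := hL _ ⟨contDiff_exp_half_mul hU hv.1, hv.2.mul_left⟩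
    rw [integral_gibbsMeasure hU.continuous] at this
    rw [← this]
    refine integral_congr_ae (ae_of_all _ fun x => ?_)
    simp only [diffusionOp_exp_half_mul hU hv.1, hg, hexp2]
    linear_combination (-(∑ i, D i (D i v) x - schrodingerPotential U x * v x) *
      exp (-(1 / 2) * U x) * h x) * hexp x
  obtain ⟨c, hc⟩ := ae_eq_const_of_isWeakSolution hU hgl hg2 hw
  refine ⟨c, (withDensity_absolutelyContinuous _ _).ae_le (hc.mono fun x hx => ?_)⟩
  rw [← hx]
  simp only [hg]
  linear_combination (-h x) * hexp x

lemma exists_integral_sub_diffusionOp_sq_le {U : E → ℝ}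
    [IsProbabilityMeasure (gibbsMeasure U)] (hU : ContDiff ℝ ∞ U) {φ : E → ℝ}
    (hφ : MemLp φ 2 (gibbsMeasure U)) (hφ0 : ∫ x, φ x ∂gibbsMeasure U = 0)
    {ε : ℝ} (hε : 0 < ε) :
    ∃ u, IsTestFunction u ∧ ∫ x, (φ x - diffusionOp U u x) ^ 2 ∂gibbsMeasure U ≤ ε := by
  have hmem : hφ.toLp φ ∈ (diffusionOpRange U).topologicalClosure := by
    rw [← Submodule.orthogonal_orthogonal_eq_closure, Submodule.mem_orthogonal]
    intro G hG
    rw [Submodule.mem_orthogonal'] at hG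
    obtain ⟨c, hc⟩ := ae_eq_const_of_integral_mul_diffusionOp_eq_zero hU
      (Lp.stronglyMeasurable G) (Lp.memLp G) fun u hu => by
        have hLu := (isTestFunction_diffusionOp hU hu).memLp (μ := gibbsMeasure U)
        have := hG (hLu.toLp _) ⟨u, hu, hLu.coeFn_toLp⟩
        rw [L2.inner_def] at this
        rw [← this]
        refine integral_congr_ae (hLu.coeFn_toLp.mono fun x hx => ?_)
        simp [hx, mul_comm]
    rw [L2.inner_def, ← mul_zero c, ← hφ0, ← integral_const_mul]
    refine integral_congr_ae ?_
    filter_upwards [hc, hφ.coeFn_toLp] with x h1 h2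
    simp [h1, h2, mul_comm]
  obtain ⟨F, ⟨u, hu, hF⟩, hd⟩ := Metric.mem_closure_iff.1 hmem (√ε) (sqrt_pos.2 hε)
  refine ⟨u, hu, ?_⟩
  have h1 : ∫ x, (φ x - diffusionOp U u x) ^ 2 ∂gibbsMeasure U = ‖hφ.toLp φ - F‖ ^ 2 := by
    rw [← real_inner_self_eq_norm_sq, L2.inner_def]
    refine integral_congr_ae ?_
    filter_upwards [hF, hφ.coeFn_toLp, Lp.coeFn_sub (hφ.toLp φ) F] with x h1 h2 h3
    rw [h3]
    simp [h1, h2, pow_two]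
  rw [h1, ← dist_eq_norm]
  calc dist (hφ.toLp φ) F ^ 2 ≤ √ε ^ 2 := by gcongr
    _ = ε := sq_sqrt hε.le

lemma exists_even_integral_sub_diffusionOp_sq_le {U : E → ℝ}
    [IsProbabilityMeasure (gibbsMeasure U)] (hU : ContDiff ℝ ∞ U)
    (hUeven : ∀ x, U (-x) = U x) {φ : E → ℝ} (hφeven : ∀ x, φ (-x) = φ x)
    (hφ : MemLp φ 2 (gibbsMeasure U)) (hφ0 : ∫ x, φ x ∂gibbsMeasure U = 0)
    {ε : ℝ} (hε : 0 < ε) :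
    ∃ u, IsTestFunction u ∧ (∀ x, u (-x) = u x) ∧
      ∫ x, (φ x - diffusionOp U u x) ^ 2 ∂gibbsMeasure U ≤ ε := by
  obtain ⟨u, hu, hle⟩ := exists_integral_sub_diffusionOp_sq_le hU hφ hφ0 hε
  have := isNegInvariant_gibbsMeasure hU.continuous hUeven
  have hun : IsTestFunction fun x => u (-x) :=
    ⟨hu.1.comp contDiff_neg, hu.2.comp_homeomorph (Homeomorph.neg E)⟩
  have hus : IsTestFunction fun x => u x + u (-x) := ⟨hu.1.add hun.1, hu.2.add hun.2⟩
  have hs : IsTestFunction fun x => 1 / 2 * (u x + u (-x)) :=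
    ⟨contDiff_const.mul hus.1, hus.2.mul_left⟩
  refine ⟨_, hs, fun x => by rw [neg_neg, add_comm], ?_⟩
  have hi : ∀ {v : E → ℝ}, IsTestFunction v →
      Integrable (fun x => (φ x - diffusionOp U v x) ^ 2) (gibbsMeasure U) := fun hv =>
    (hφ.sub (isTestFunction_diffusionOp hU hv).memLp).integrable_sq
  have hin := (hi hu).comp_neg
  refine (integral_mono (hi hs) (((hi hu).add hin).const_mul (1 / 2)) fun x => ?_).trans ?_
  · simp only [Pi.add_apply, hφeven]
    rw [diffusionOp_const_mul hus.1, diffusionOp_add hu.1 hun.1,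
      diffusionOp_comp_neg hUeven hu.1]
    nlinarith [sq_nonneg (diffusionOp U u x - diffusionOp U u (-x))]
  · rw [integral_const_mul, integral_add' (hi hu) hin,
      integral_neg_eq_self (fun x => (φ x - diffusionOp U u x) ^ 2) (gibbsMeasure U)]
    linarith

lemma mul_integral_sq_le_of_approx {U : E → ℝ} [IsProbabilityMeasure (gibbsMeasure U)]
    (hU : ContDiff ℝ ∞ U) {κ : ℝ} (hκ : 0 < κ) {φ : E → ℝ} (hφs : ContDiff ℝ ∞ φ)
    (hφ : MemLp φ 2 (gibbsMeasure U)) (hDφ : ∀ i, MemLp (D i φ) 2 (gibbsMeasure U))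
    (happrox : ∀ ε > 0, ∃ u, IsTestFunction u ∧
      κ * ∑ i, ∫ x, D i u x ^ 2 ∂gibbsMeasure U ≤ ∫ x, diffusionOp U u x ^ 2 ∂gibbsMeasure U ∧
      ∫ x, (φ x - diffusionOp U u x) ^ 2 ∂gibbsMeasure U ≤ ε) :
    κ * ∫ x, φ x ^ 2 ∂gibbsMeasure U ≤ ∑ i, ∫ x, D i φ x ^ 2 ∂gibbsMeasure U := by
  refine le_of_forall_pos_le_add fun ε hε => ?_
  obtain ⟨u, hu, hκu, hle⟩ := happrox (ε / κ) (by positivity)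
  have hL := (isTestFunction_diffusionOp hU hu).memLp (μ := gibbsMeasure U)
  have hD := fun i => (hu.partialDeriv i).memLp (μ := gibbsMeasure U)
  have e : ∀ x, (φ x - diffusionOp U u x) ^ 2
      = φ x ^ 2 - 2 * (φ x * diffusionOp U u x) + diffusionOp U u x ^ 2 := fun x => by ring
  have i1 : Integrable (fun x => φ x * diffusionOp U u x) (gibbsMeasure U) :=
    hφ.integrable_mul hL
  have i3 : Integrable (fun x => φ x ^ 2 - 2 * (φ x * diffusionOp U u x)) (gibbsMeasure U) :=
    hφ.integrable_sq.sub (i1.const_mul 2)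
  simp only [e] at hle
  rw [integral_add i3 hL.integrable_sq, integral_sub hφ.integrable_sq (i1.const_mul 2),
    integral_const_mul, integral_mul_diffusionOp hU hφs hu.1 (Or.inr hu.2)] at hle
  have hi : ∀ i, -(2 * κ * ∫ x, D i φ x * D i u x ∂gibbsMeasure U)
      ≤ ∫ x, D i φ x ^ 2 ∂gibbsMeasure U + κ ^ 2 * ∫ x, D i u x ^ 2 ∂gibbsMeasure U := by
    intro i
    have i2 : Integrable (fun x => D i φ x * D i u x) (gibbsMeasure U) :=
      (hDφ i).integrable_mul (hD i)
    rw [← integral_const_mul, ← integral_const_mul, ← integral_neg,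
      ← integral_add (hDφ i).integrable_sq ((hD i).integrable_sq.const_mul _)]
    refine integral_mono (i2.const_mul _).neg
      ((hDφ i).integrable_sq.add ((hD i).integrable_sq.const_mul _)) fun x => ?_
    linarith [sq_nonneg (D i φ x + κ * D i u x)]
  have hsum := Finset.sum_le_sum fun i (_ : i ∈ Finset.univ) => hi i
  rw [Finset.sum_neg_distrib, Finset.sum_add_distrib, ← Finset.mul_sum, ← Finset.mul_sum] at hsum
  have h1 := mul_le_mul_of_nonneg_left hle hκ.le
  rw [mul_div_cancel₀ _ hκ.ne'] at h1
  have h2 := mul_le_mul_of_nonneg_left hκu hκ.le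
  generalize ∑ i, ∫ x, D i φ x ^ 2 ∂gibbsMeasure U = G at *
  generalize ∑ i, ∫ x, D i u x ^ 2 ∂gibbsMeasure U = s at *
  generalize ∑ i, ∫ x, D i φ x * D i u x ∂gibbsMeasure U = S at *
  linarith

/-- Poincaré inequality for test functions. -/
lemma integral_sq_le_sum_integral_partialDeriv_sq {U : E → ℝ}
    [IsProbabilityMeasure (gibbsMeasure U)] (hU : ContDiff ℝ ∞ U)
    (hHess : ∀ x v : E, ‖v‖ ^ 2 ≤ fderiv ℝ (fderiv ℝ U) x v v) {w : E → ℝ}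
    (hw : IsTestFunction w) (hw0 : ∫ x, w x ∂gibbsMeasure U = 0) :
    ∫ x, w x ^ 2 ∂gibbsMeasure U ≤ ∑ i, ∫ x, D i w x ^ 2 ∂gibbsMeasure U := by
  rw [← one_mul (∫ x, w x ^ 2 ∂gibbsMeasure U)]
  refine mul_integral_sq_le_of_approx hU one_pos hw.1 hw.memLp
    (fun i => (hw.partialDeriv i).memLp) fun ε hε => ?_
  obtain ⟨u, hu, h⟩ := exists_integral_sub_diffusionOp_sq_le hU hw.memLp hw0 hε
  refine ⟨u, hu, ?_, h⟩
  have h1 := le_integral_diffusionOp_sq hU hHess hu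
  have h2 : 0 ≤ ∑ j, ∑ i, ∫ x, D i (D j u) x ^ 2 ∂gibbsMeasure U :=
    Finset.sum_nonneg fun j _ => Finset.sum_nonneg fun i _ =>
      integral_nonneg fun x => sq_nonneg _
  linarith

lemma two_mul_sum_integral_partialDeriv_sq_le {U : E → ℝ}
    [IsProbabilityMeasure (gibbsMeasure U)] (hU : ContDiff ℝ ∞ U)
    (hUeven : ∀ x, U (-x) = U x)
    (hHess : ∀ x v : E, ‖v‖ ^ 2 ≤ fderiv ℝ (fderiv ℝ U) x v v) {u : E → ℝ}
    (hu : IsTestFunction u) (hueven : ∀ x, u (-x) = u x) :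
    2 * ∑ i, ∫ x, D i u x ^ 2 ∂gibbsMeasure U
      ≤ ∫ x, diffusionOp U u x ^ 2 ∂gibbsMeasure U := by
  have := isNegInvariant_gibbsMeasure hU.continuous hUeven
  have hodd : ∀ j, ∫ x, D j u x ∂gibbsMeasure U = 0 := fun j => by
    have h1 := partialDeriv_comp_neg (u := u) j
    simp only [hueven] at h1
    have h2 := integral_neg_eq_self (D j u) (gibbsMeasure U)
    have h3 : ∫ x, D j u x ∂gibbsMeasure U = -∫ x, D j u (-x) ∂gibbsMeasure U := by
      rw [← integral_neg]
      exact congrArg (fun F => ∫ x, F x ∂gibbsMeasure U) h1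
    linarith
  have hP := Finset.sum_le_sum fun j (_ : j ∈ Finset.univ) =>
    integral_sq_le_sum_integral_partialDeriv_sq hU hHess (hu.partialDeriv j) (hodd j)
  have hB := le_integral_diffusionOp_sq hU hHess hu
  linarith

end EvenPoincare

/-- the Cordero-Erausquin–Fradelizi–Maurey inequality underlying the
(B)-Theorem, in the even case: for an even probability measure `dμ = e^{-U} dx`
with `Hess U ≥ Id` and every smooth bounded even `f` with bounded derivatives,
`∫ f² dμ − (∫ f dμ)² ≤ (1/2) ∫ ‖∇f‖² dμ`. -/
theorem stmt_18 (n : ℕ)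
    (U : EuclideanSpace ℝ (Fin n) → ℝ) (hU : ContDiff ℝ (⊤ : ℕ∞) U)
    (hUeven : ∀ x, U (-x) = U x)
    (hHess : ∀ x v : EuclideanSpace ℝ (Fin n), ‖v‖ ^ 2 ≤ fderiv ℝ (fderiv ℝ U) x v v)
    (μ : Measure (EuclideanSpace ℝ (Fin n)))
    (hμ : μ = volume.withDensity (fun x => ENNReal.ofReal (Real.exp (-U x))))
    (hprob : IsProbabilityMeasure μ)
    (f : EuclideanSpace ℝ (Fin n) → ℝ)
    (hf : ContDiff ℝ (⊤ : ℕ∞) f)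
    (hfeven : ∀ x, f (-x) = f x)
    (hfd : ∀ i : ℕ, ∃ C : ℝ, ∀ x, ‖iteratedFDeriv ℝ i f x‖ ≤ C) :
    ∫ x, (f x) ^ 2 ∂μ - (∫ x, f x ∂μ) ^ 2 ≤ (1 / 2) * ∫ x, ‖fderiv ℝ f x‖ ^ 2 ∂μ := by
  change μ = gibbsMeasure U at hμ
  subst hμ
  obtain ⟨C₀, hC₀⟩ := hfd 0
  obtain ⟨C₁, hC₁⟩ := hfd 1
  simp only [norm_iteratedFDeriv_zero, norm_iteratedFDeriv_one] at hC₀ hC₁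
  have hfL : MemLp f 2 (gibbsMeasure U) :=
    MemLp.of_bound hf.continuous.aestronglyMeasurable C₀ (ae_of_all _ hC₀)
  set m := ∫ x, f x ∂gibbsMeasure U with hm
  have hfi : Integrable f (gibbsMeasure U) := hfL.integrable (by norm_num)
  have hDf : ∀ i, partialDeriv i (fun x => f x - m) = partialDeriv i f := fun i => by
    ext x
    simp only [partialDeriv, fderiv_sub_const]
  have hDL : ∀ i, MemLp (partialDeriv i f) 2 (gibbsMeasure U) := fun i => by
    refine MemLp.of_bound (hf.continuous_partialDeriv i).aestronglyMeasurable C₁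
      (ae_of_all _ fun x => (ContinuousLinearMap.le_opNorm _ _).trans ?_)
    simpa using hC₁ x
  have hL : MemLp (fun x => f x - m) 2 (gibbsMeasure U) := hfL.sub (memLp_const m)
  have h0 : ∫ x, (f x - m) ∂gibbsMeasure U = 0 := by
    rw [integral_sub hfi (integrable_const m), ← hm]
    simp
  have key := mul_integral_sq_le_of_approx hU two_pos (hf.sub contDiff_const) hL
    (fun i => by rw [hDf]; exact hDL i) fun ε hε => by
      obtain ⟨u, hu, hueven, hle⟩ := exists_even_integral_sub_diffusionOp_sq_le hU hUeven
        (fun x => by rw [hfeven]) hL h0 hε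
      exact ⟨u, hu, two_mul_sum_integral_partialDeriv_sq_le hU hUeven hHess hu hueven, hle⟩
  simp only [hDf] at key
  rw [← integral_finsetSum _ fun i _ => (hDL i).integrable_sq] at key
  simp only [← norm_fderiv_sq_eq_sum_partialDeriv_sq] at key
  have e : ∀ x, (f x - m) ^ 2 = f x ^ 2 - 2 * m * f x + m ^ 2 := fun x => by ring
  simp only [e] at key
  rw [integral_add (f := fun x => _ - _) (hfL.integrable_sq.sub (hfi.const_mul _))
    (integrable_const _), integral_sub hfL.integrable_sq (hfi.const_mul _),
    integral_const_mul, ← hm] at key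
  simp only [integral_const, probReal_univ, smul_eq_mul, one_mul] at key
  linarith
end
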